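/- Assume Σ is crystallographic and d ≥ 3. There is a unique continuous function T_N on D = {(X,Y) : X ≠ wY for all w ∈ W} with T_N(X,Y) = (π(X)π(Y))^{−1} ∑_{w∈W} det(w) |X − wY|^{2−d} whenever π(X)π(Y) ≠ 0. Let Y₀ ∈ ℝ^d, and set Σ'₊ = {α ∈ Σ⁺ : ⟨α,Y₀⟩ = 0}, γ' = |Σ'₊|, ρ' = ∑_{α∈Σ'₊} α, π'(X) = ∏_{α∈Σ'₊} ⟨α,X⟩, π''(X) = ∏_{α∈Σ⁺∖Σ'₊} ⟨α,X⟩. Then lim_{X→Y₀, (X,Y₀)∈D} |X − Y₀|^{2γ'+d−2} · T_N(X, Y₀) = 2^{2γ'} ((d−2)/2)_{γ'} / (π'(ρ') · π''(Y₀)²). Equivalently, the Newton kernel N^W(X,Y₀) = (|W|(2−d)w_d)^{−1} T_N(X,Y₀) satisfies N^W(X,Y₀) ∼ [2^{2γ'} ((d−2)/2)_{γ'} / (|W|(2−d) w_d π'(ρ') π''(Y₀)²)] · |X−Y₀|^{−(2γ'+d−2)} as X → Y₀, where w_d = 2π^{d/2}/Γ(d/2). -/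

import Mathlib

open scoped BigOperators RealInnerProductSpace Classical
open Finset

noncomputable section

/-- Euclidean space `ℝ^d`. -/
abbrev E (d : ℕ) := EuclideanSpace ℝ (Fin d)

/-- The reflection `s_α x = x - 2 (⟪α, x⟫/⟪α, α⟫) α` fixing the hyperplane `α^⊥`. -/
def reflVec {d : ℕ} (α x : E d) : E d := x - (2 * ⟪α, x⟫ / ⟪α, α⟫) • α

/-- `Sig` is a reduced root system in `ℝ^d`: a finite set of nonzero vectors spanning `ℝ^d`,
with `Sig ∩ ℝα = {α, -α}` and `s_α (Sig) = Sig` for all `α ∈ Sig`. -/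
def IsRootSystem {d : ℕ} (Sig : Finset (E d)) : Prop :=
  (0 : E d) ∉ Sig ∧
  Submodule.span ℝ (Sig : Set (E d)) = ⊤ ∧
  (∀ α ∈ Sig, ∀ t : ℝ, t • α ∈ Sig → t = 1 ∨ t = -1) ∧
  (∀ α ∈ Sig, ∀ β ∈ Sig, reflVec α β ∈ Sig)

/-- `Sp` is a positive system for `Sig`: `Sp = {α ∈ Sig : ⟪α, v⟫ > 0}` for a vector `v` not
orthogonal to any root. -/
def IsPositiveSystem {d : ℕ} (Sig Sp : Finset (E d)) : Prop :=
  ∃ v : E d, (∀ α ∈ Sig, ⟪α, v⟫ ≠ 0) ∧ ∀ α : E d, α ∈ Sp ↔ α ∈ Sig ∧ 0 < ⟪α, v⟫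

/-- The Weyl group of `Sig`: the subgroup of the orthogonal group of `ℝ^d` generated by the
reflections `s_α`, `α ∈ Sig`. -/
def weylGroup {d : ℕ} (Sig : Finset (E d)) : Subgroup (E d ≃ₗᵢ[ℝ] E d) :=
  Subgroup.closure {w : E d ≃ₗᵢ[ℝ] E d | ∃ α ∈ Sig, ∀ x : E d, w x = reflVec α x}

/-- Determinant of an orthogonal transformation (`±1`). -/
def dsign {d : ℕ} (w : E d ≃ₗᵢ[ℝ] E d) : ℝ := LinearMap.det (w.toLinearEquiv.toLinearMap)

/-- `π(X) = ∏_{α ∈ Sp} ⟪α, X⟫`. -/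
def piP {d : ℕ} (Sp : Finset (E d)) (X : E d) : ℝ := ∏ α ∈ Sp, ⟪α, X⟫

/-- The set `D = {(X,Y) : X ≠ wY for all w ∈ W}`. -/
def Dset {d : ℕ} (Sig : Finset (E d)) : Set (E d × E d) :=
  {p : E d × E d | ∀ w : weylGroup Sig, p.1 ≠ w.1 p.2}

section

open Filter Topology
open scoped ContDiff

/-- The orthogonal reflection `s_α` as a linear isometry equivalence. -/
def reflIso {d : ℕ} (α : E d) : E d ≃ₗᵢ[ℝ] E d := (Submodule.span ℝ {α})ᗮ.reflection

lemma reflIso_apply {d : ℕ} (α x : E d) : reflIso α x = reflVec α x := by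
  rw [reflIso, Submodule.reflection_orthogonal_apply, Submodule.reflection_singleton_apply, reflVec]
  simp only [real_inner_self_eq_norm_sq, RCLike.ofReal_real_eq_id, id]
  rw [neg_sub, two_smul, mul_div_assoc, two_mul, add_smul]

lemma reflIso_self {d : ℕ} (α : E d) : reflIso α α = -α :=
  Submodule.reflection_orthogonalComplement_singleton_eq_neg α

lemma reflIso_reflIso {d : ℕ} (α x : E d) : reflIso α (reflIso α x) = x :=
  Submodule.reflection_reflection _ x

lemma reflIso_mul_self {d : ℕ} (α : E d) : reflIso α * reflIso α = 1 := by
  ext1 x; exact reflIso_reflIso α x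

lemma reflIso_inv {d : ℕ} (α : E d) : (reflIso α)⁻¹ = reflIso α :=
  inv_eq_of_mul_eq_one_left (reflIso_mul_self α)

lemma reflIso_neg {d : ℕ} (α : E d) : reflIso (-α) = reflIso α := by
  ext1 x; simp [reflIso_apply, reflVec, inner_neg_left, neg_div]

lemma reflIso_eq_of_inner_eq_zero {d : ℕ} {α x : E d} (h : ⟪α, x⟫ = 0) : reflIso α x = x := by
  simp [reflIso_apply, reflVec, h]

lemma inner_map_inv {d : ℕ} (w : E d ≃ₗᵢ[ℝ] E d) (x y : E d) : ⟪w⁻¹ x, y⟫ = ⟪x, w y⟫ := by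
  rw [← w.inner_map_map (w⁻¹ x) y]
  congr 1
  exact w.apply_symm_apply x

lemma inner_map_reflIso {d : ℕ} (α x y : E d) : ⟪reflIso α x, y⟫ = ⟪x, reflIso α y⟫ := by
  rw [← inner_map_inv, reflIso_inv]

lemma reflIso_map {d : ℕ} (w : E d ≃ₗᵢ[ℝ] E d) (α : E d) :
    reflIso (w α) = w * reflIso α * w⁻¹ := by
  ext1 x
  have hx : x = w (w⁻¹ x) := (w.apply_symm_apply x).symm
  generalize w⁻¹ x = y at hx
  subst hx
  simp [reflIso_apply, reflVec]

lemma dsign_one {d : ℕ} : dsign (1 : E d ≃ₗᵢ[ℝ] E d) = 1 := LinearMap.det_id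

lemma dsign_mul {d : ℕ} (v w : E d ≃ₗᵢ[ℝ] E d) : dsign (v * w) = dsign v * dsign w :=
  LinearMap.det_comp _ _

lemma dsign_reflIso {d : ℕ} {α : E d} (h : α ≠ 0) : dsign (reflIso α) = -1 := by
  have := Submodule.det_reflection (𝕜 := ℝ) (Submodule.span ℝ {α})ᗮ
  rw [Submodule.orthogonal_orthogonal, finrank_span_singleton h, pow_one] at this
  exact this

/-- A finite reduced crystallographic root system, not required to span. -/
structure IsRootSet {d : ℕ} (S : Finset (E d)) : Prop where
  zero_notMem : (0 : E d) ∉ S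
  reduced : ∀ α ∈ S, ∀ t : ℝ, t • α ∈ S → t = 1 ∨ t = -1
  reflIso_mem : ∀ α ∈ S, ∀ β ∈ S, reflIso α β ∈ S
  crystallographic : ∀ α ∈ S, ∀ β ∈ S, ∃ z : ℤ, 2 * ⟪α, β⟫ / ⟪β, β⟫ = (z : ℝ)

/-- The roots that are positive with respect to `v`. -/
def posRoots {d : ℕ} (S : Finset (E d)) (v : E d) : Finset (E d) := S.filter (fun α => 0 < ⟪α, v⟫)

/-- The positive roots that are not a sum of two positive roots. -/
def simpleRoots {d : ℕ} (S : Finset (E d)) (v : E d) : Finset (E d) :=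
  (posRoots S v).filter (fun α => ∀ β ∈ posRoots S v, ∀ γ ∈ posRoots S v, α ≠ β + γ)

lemma mem_posRoots {d : ℕ} {S : Finset (E d)} {v α : E d} :
    α ∈ posRoots S v ↔ α ∈ S ∧ 0 < ⟪α, v⟫ := by simp [posRoots]

lemma posRoots_of_mem_simpleRoots {d : ℕ} {S : Finset (E d)} {v α : E d}
    (h : α ∈ simpleRoots S v) : α ∈ posRoots S v := (mem_filter.1 h).1

/-- Induction on positive roots: a property of the simple roots that is stable under sums holds
for all positive roots. -/
lemma posRoots_induction {d : ℕ} {S : Finset (E d)} {v : E d} (p : E d → Prop)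
    (hs : ∀ α ∈ simpleRoots S v, p α)
    (hadd : ∀ β ∈ posRoots S v, ∀ γ ∈ posRoots S v, p β → p γ → p (β + γ)) :
    ∀ β ∈ posRoots S v, p β := by
  by_contra! hcon
  have hne : ((posRoots S v).filter (fun β => ¬ p β)).Nonempty := by
    obtain ⟨β, hβ, hp⟩ := hcon
    exact ⟨β, mem_filter.2 ⟨hβ, hp⟩⟩
  obtain ⟨β, hβ, hmin⟩ := exists_min_image _ (fun β => ⟪β, v⟫) hne
  rw [mem_filter] at hβ
  have hns : β ∉ simpleRoots S v := fun h => hβ.2 (hs β h)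
  simp only [simpleRoots, mem_filter, hβ.1, true_and, not_forall, not_not] at hns
  obtain ⟨γ, hγ, δ, hδ, hsum⟩ := hns
  have hγv := (mem_posRoots.1 hγ).2
  have hδv := (mem_posRoots.1 hδ).2
  have hv : ⟪β, v⟫ = ⟪γ, v⟫ + ⟪δ, v⟫ := by rw [hsum, inner_add_left]
  refine hβ.2 (hsum ▸ hadd γ hγ δ hδ ?_ ?_)
  · by_contra hp
    have := hmin γ (mem_filter.2 ⟨hγ, hp⟩)
    linarith
  · by_contra hp
    have := hmin δ (mem_filter.2 ⟨hδ, hp⟩)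
    linarith

lemma exists_simpleRoots_inner_pos {d : ℕ} {S : Finset (E d)} {v β y : E d}
    (hβ : β ∈ posRoots S v) (hy : 0 < ⟪β, y⟫) : ∃ α ∈ simpleRoots S v, 0 < ⟪α, y⟫ := by
  by_contra! hcon
  have := posRoots_induction (S := S) (v := v) (fun β => ⟪β, y⟫ ≤ 0) hcon
    (fun β _ γ _ h1 h2 => by rw [inner_add_left]; linarith) β hβ
  linarith

namespace IsRootSet

variable {d : ℕ} {S : Finset (E d)} {v : E d}

lemma ne_zero (hS : IsRootSet S) {α : E d} (hα : α ∈ S) : α ≠ 0 :=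
  fun h => hS.zero_notMem (h ▸ hα)

lemma inner_self_pos (hS : IsRootSet S) {α : E d} (hα : α ∈ S) : 0 < ⟪α, α⟫ :=
  real_inner_self_pos.2 (hS.ne_zero hα)

lemma neg_mem (hS : IsRootSet S) {α : E d} (hα : α ∈ S) : -α ∈ S :=
  reflIso_self α ▸ hS.reflIso_mem α hα α hα

/-- Strict Cauchy-Schwarz for two roots that are not proportional. -/
lemma inner_mul_inner_lt (hS : IsRootSet S) {α β : E d} (hα : α ∈ S) (hβ : β ∈ S)
    (h1 : α ≠ β) (h2 : α ≠ -β) : ⟪α, β⟫ * ⟪α, β⟫ < ⟪α, α⟫ * ⟪β, β⟫ := by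
  refine lt_of_le_of_ne (real_inner_mul_inner_self_le α β) fun heq => ?_
  have hn : |⟪α, β⟫| = ‖α‖ * ‖β‖ := by
    rw [real_inner_self_eq_norm_sq, real_inner_self_eq_norm_sq] at heq
    rw [← abs_of_nonneg (mul_nonneg (norm_nonneg α) (norm_nonneg β)), ← sq_eq_sq_iff_abs_eq_abs]
    linarith
  have hne : ‖α‖ * ‖β‖ ≠ 0 := by
    simp [hS.ne_zero hα, hS.ne_zero hβ]
  obtain ⟨-, r, hr, hr'⟩ := (abs_real_inner_div_norm_mul_norm_eq_one_iff α β).1 (by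
    rw [abs_div, hn, abs_of_nonneg (by positivity), div_self hne])
  rcases hS.reduced α hα r (hr' ▸ hβ) with rfl | rfl
  · exact h1 (by simp [hr'])
  · exact h2 (by simp [hr'])

lemma sub_mem (hS : IsRootSet S) {α β : E d} (hα : α ∈ S) (hβ : β ∈ S) (hne : α ≠ β)
    (h : 0 < ⟪α, β⟫) : α - β ∈ S := by
  have ha := hS.inner_self_pos hα
  have hb := hS.inner_self_pos hβ
  have hne2 : α ≠ -β := by
    rintro rfl
    rw [inner_neg_left] at h; linarith
  have hcs := hS.inner_mul_inner_lt hα hβ hne hne2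
  obtain ⟨m, hm⟩ := hS.crystallographic α hα β hβ
  obtain ⟨n, hn⟩ := hS.crystallographic β hβ α hα
  rw [real_inner_comm] at hn
  have hm0 : 0 < m := by
    have : (0 : ℝ) < m := by rw [← hm]; positivity
    exact_mod_cast this
  have hn0 : 0 < n := by
    have : (0 : ℝ) < n := by rw [← hn]; positivity
    exact_mod_cast this
  have hmn : m * n < 4 := by
    have : (m * n : ℝ) < 4 := by
      rw [← hm, ← hn, div_mul_div_comm, div_lt_iff₀ (by positivity)]
      linarith
    exact_mod_cast this
  have h1 : m = 1 ∨ n = 1 := by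
    by_contra! hc
    have : 2 ≤ m := by omega
    have : 2 ≤ n := by omega
    nlinarith
  rcases h1 with rfl | rfl
  · have := hS.reflIso_mem β hβ α hα
    rwa [reflIso_apply, reflVec, real_inner_comm, hm, Int.cast_one, one_smul] at this
  · have := hS.neg_mem (hS.reflIso_mem α hα β hβ)
    rwa [reflIso_apply, reflVec, hn, Int.cast_one, one_smul, neg_sub] at this

lemma posRoots_or_neg (hS : IsRootSet S) (hv : ∀ α ∈ S, ⟪α, v⟫ ≠ 0) {α : E d} (hα : α ∈ S) :
    α ∈ posRoots S v ∨ -α ∈ posRoots S v := by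
  simp only [mem_posRoots, hα, hS.neg_mem hα, true_and, inner_neg_left]
  rcases lt_or_gt_of_ne (hv α hα) with h | h
  · right; linarith
  · left; exact h

lemma neg_mem_posRoots (hS : IsRootSet S) (hv : ∀ α ∈ S, ⟪α, v⟫ ≠ 0) {α : E d} (hα : α ∈ S)
    (h : α ∉ posRoots S v) : -α ∈ posRoots S v := (hS.posRoots_or_neg hv hα).resolve_left h

/-- A simple reflection permutes the positive roots other than its own root. -/
lemma reflIso_mem_posRoots (hS : IsRootSet S) (hv : ∀ α ∈ S, ⟪α, v⟫ ≠ 0) {α : E d}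
    (hα : α ∈ simpleRoots S v) : ∀ β ∈ posRoots S v, β ≠ α → reflIso α β ∈ posRoots S v := by
  have hαP := posRoots_of_mem_simpleRoots hα
  have hαS := (mem_posRoots.1 hαP).1
  have hind := (mem_filter.1 hα).2
  by_contra! hcon
  have hne : ((posRoots S v).filter
      (fun β => β ≠ α ∧ reflIso α β ∉ posRoots S v)).Nonempty := by
    obtain ⟨β, hβ, hp⟩ := hcon
    exact ⟨β, mem_filter.2 ⟨hβ, hp⟩⟩
  obtain ⟨β, hβ, hmin⟩ := exists_min_image _ (fun β => ⟪β, v⟫) hne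
  rw [mem_filter] at hβ
  obtain ⟨hβP, hβα, hneg⟩ := hβ
  have hβS := (mem_posRoots.1 hβP).1
  have hrS := hS.reflIso_mem α hαS β hβS
  have hnegP := hS.neg_mem_posRoots hv hrS hneg
  rcases le_or_gt ⟪α, β⟫ 0 with h | h
  · apply hneg
    refine mem_posRoots.2 ⟨hrS, ?_⟩
    rw [reflIso_apply, reflVec, inner_sub_left, inner_smul_left]
    have h1 : 2 * ⟪α, β⟫ / ⟪α, α⟫ ≤ 0 :=
      div_nonpos_of_nonpos_of_nonneg (by linarith) (hS.inner_self_pos hαS).le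
    have h2 := (mem_posRoots.1 hβP).2
    have h3 := (mem_posRoots.1 hαP).2
    simp only [conj_trivial]
    nlinarith
  · rw [real_inner_comm] at h
    have hsub := hS.sub_mem hβS hαS hβα h
    have hsubP : β - α ∈ posRoots S v := by
      by_contra hc
      have := hS.neg_mem_posRoots hv hsub hc
      exact hind β hβP _ this (by abel)
    have hsubne : β - α ≠ α := by
      intro hc
      have h2 : (2 : ℝ) • α ∈ S := by
        rw [two_smul, ← eq_add_of_sub_eq hc]; exact hβS
      rcases hS.reduced α hαS 2 h2 with h | h <;> norm_num at h
    have hP : reflIso α (β - α) ∈ posRoots S v := by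
      by_contra hc
      have := hmin (β - α) (mem_filter.2 ⟨hsubP, hsubne, hc⟩)
      have h3 := (mem_posRoots.1 hαP).2
      rw [inner_sub_left] at this
      linarith
    refine hind _ hP _ hnegP ?_
    rw [map_sub, reflIso_self]; abel

lemma reflIso_mem_closure (hS : IsRootSet S) (hv : ∀ α ∈ S, ⟪α, v⟫ ≠ 0) :
    ∀ β ∈ posRoots S v,
      reflIso β ∈ Subgroup.closure (reflIso '' (simpleRoots S v : Set (E d))) := by
  by_contra! hcon
  have hne : ((posRoots S v).filter (fun β => reflIso β ∉
      Subgroup.closure (reflIso '' (simpleRoots S v : Set (E d))))).Nonempty := by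
    obtain ⟨β, hβ, hp⟩ := hcon
    exact ⟨β, mem_filter.2 ⟨hβ, hp⟩⟩
  obtain ⟨β, hβ, hmin⟩ := exists_min_image _ (fun β => ⟪β, v⟫) hne
  rw [mem_filter] at hβ
  obtain ⟨hβP, hβ⟩ := hβ
  have hβS := (mem_posRoots.1 hβP).1
  obtain ⟨α, hα, hpos⟩ := exists_simpleRoots_inner_pos hβP (hS.inner_self_pos hβS)
  have hαP := posRoots_of_mem_simpleRoots hα
  have hαS := (mem_posRoots.1 hαP).1
  have hαc := Subgroup.subset_closure (Set.mem_image_of_mem reflIso hα)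
  have hne' : β ≠ α := by rintro rfl; exact hβ hαc
  have hP := hS.reflIso_mem_posRoots hv hα β hβP hne'
  have hc : reflIso (reflIso α β) ∈
      Subgroup.closure (reflIso '' (simpleRoots S v : Set (E d))) := by
    by_contra hc
    have := hmin _ (mem_filter.2 ⟨hP, hc⟩)
    rw [reflIso_apply, reflVec, inner_sub_left, inner_smul_left] at this
    have h1 : 0 < 2 * ⟪α, β⟫ / ⟪α, α⟫ := by
      have := hS.inner_self_pos hαS
      positivity
    have h3 := (mem_posRoots.1 hαP).2
    simp only [conj_trivial] at this
    nlinarith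
  apply hβ
  rw [reflIso_map, reflIso_inv] at hc
  have := mul_mem (mul_mem hαc hc) hαc
  rwa [mul_assoc, mul_assoc, mul_assoc, reflIso_mul_self, mul_one, ← mul_assoc, reflIso_mul_self,
    one_mul] at this

lemma weylGroup_eq (S : Finset (E d)) :
    weylGroup S = Subgroup.closure (reflIso '' (S : Set (E d))) := by
  rw [weylGroup]
  congr 1
  ext w
  simp only [Set.mem_ofPred_eq, Set.mem_image, mem_coe]
  refine exists_congr fun α => and_congr_right fun _ => ⟨fun h => ?_, fun h x => ?_⟩
  · ext1 x; rw [h, reflIso_apply]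
  · rw [← h, reflIso_apply]

lemma reflIso_mem_weylGroup {α : E d} (hα : α ∈ S) : reflIso α ∈ weylGroup S := by
  rw [weylGroup_eq]; exact Subgroup.subset_closure (Set.mem_image_of_mem _ hα)

/-- The Weyl group is generated by the simple reflections. -/
lemma weylGroup_eq_closure_simple (hS : IsRootSet S) (hv : ∀ α ∈ S, ⟪α, v⟫ ≠ 0) :
    weylGroup S = Subgroup.closure (reflIso '' (simpleRoots S v : Set (E d))) := by
  apply le_antisymm
  · rw [weylGroup_eq, Subgroup.closure_le]
    rintro _ ⟨α, hα, rfl⟩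
    rcases hS.posRoots_or_neg hv hα with h | h
    · exact hS.reflIso_mem_closure hv α h
    · rw [← reflIso_neg]; exact hS.reflIso_mem_closure hv _ h
  · rw [Subgroup.closure_le]
    rintro _ ⟨α, hα, rfl⟩
    exact reflIso_mem_weylGroup (mem_posRoots.1 (posRoots_of_mem_simpleRoots hα)).1

/-- Induction along words in the simple reflections. -/
lemma weylGroup_induction (hS : IsRootSet S) (hv : ∀ α ∈ S, ⟪α, v⟫ ≠ 0)
    {p : (E d ≃ₗᵢ[ℝ] E d) → Prop} (one : p 1)
    (mul : ∀ α ∈ simpleRoots S v, ∀ w ∈ weylGroup S, p w → p (reflIso α * w)) :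
    ∀ w ∈ weylGroup S, p w := by
  intro w hw
  have hw' := hw
  rw [hS.weylGroup_eq_closure_simple hv] at hw'
  induction hw' using Subgroup.closure_induction_left with
  | one => exact one
  | mul_left x hx y hy ih =>
    obtain ⟨α, hα, rfl⟩ := hx
    rw [← hS.weylGroup_eq_closure_simple hv] at hy
    exact mul α hα y hy (ih hy)
  | inv_mul_cancel x hx y hy ih =>
    obtain ⟨α, hα, rfl⟩ := hx
    rw [← hS.weylGroup_eq_closure_simple hv] at hy
    rw [reflIso_inv]
    exact mul α hα y hy (ih hy)

lemma map_mem (hS : IsRootSet S) {w : E d ≃ₗᵢ[ℝ] E d} (hw : w ∈ weylGroup S) :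
    ∀ β ∈ S, w β ∈ S := by
  rw [weylGroup_eq] at hw
  induction hw using Subgroup.closure_induction_left with
  | one => exact fun β hβ => hβ
  | mul_left x hx y hy ih =>
    obtain ⟨α, hα, rfl⟩ := hx
    exact fun β hβ => hS.reflIso_mem α hα _ (ih β hβ)
  | inv_mul_cancel x hx y hy ih =>
    obtain ⟨α, hα, rfl⟩ := hx
    rw [reflIso_inv]
    exact fun β hβ => hS.reflIso_mem α hα _ (ih β hβ)

lemma exists_list_prod (hS : IsRootSet S) (hv : ∀ α ∈ S, ⟪α, v⟫ ≠ 0) :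
    ∀ w ∈ weylGroup S, ∃ l : List (E d), (∀ α ∈ l, α ∈ simpleRoots S v) ∧
      w = (l.map reflIso).prod := by
  refine hS.weylGroup_induction hv ⟨[], by simp, by simp⟩ ?_
  rintro α hα w - ⟨l, hl, rfl⟩
  exact ⟨α :: l, by simpa [hα] using hl, by simp⟩

/-- The exchange condition. -/
lemma exchange (hS : IsRootSet S) (hv : ∀ α ∈ S, ⟪α, v⟫ ≠ 0) {β : E d} (hβ : β ∈ posRoots S v)
    (l : List (E d)) (hl : ∀ α ∈ l, α ∈ simpleRoots S v)
    (h : (l.map reflIso).prod β ∉ posRoots S v) :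
    ∃ m : List (E d), (∀ α ∈ m, α ∈ simpleRoots S v) ∧ m.length + 1 = l.length ∧
      (l.map reflIso).prod * reflIso β = (m.map reflIso).prod := by
  induction l with
  | nil => simp at h; exact absurd hβ h
  | cons a l ih =>
    simp only [List.mem_cons, forall_eq_or_imp] at hl
    rw [List.map_cons, List.prod_cons] at h ⊢
    by_cases hc : (l.map reflIso).prod β ∈ posRoots S v
    · have hγ : (l.map reflIso).prod β = a := by
        by_contra hne
        exact h (hS.reflIso_mem_posRoots hv hl.1 _ hc hne)
      refine ⟨l, hl.2, by simp, ?_⟩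
      nth_rewrite 1 [← hγ]
      rw [reflIso_map]
      simp only [mul_assoc]
      rw [inv_mul_cancel_left, reflIso_mul_self, mul_one]
    · obtain ⟨m, hm, hlen, hprod⟩ := ih hl.2 hc
      exact ⟨a :: m, by simpa [hl.1] using hm, by simp [hlen], by
        rw [mul_assoc, hprod, List.map_cons, List.prod_cons]⟩

lemma list_prod_eq_one (hS : IsRootSet S) (hv : ∀ α ∈ S, ⟪α, v⟫ ≠ 0) (n : ℕ) :
    ∀ l : List (E d), l.length = n → (∀ α ∈ l, α ∈ simpleRoots S v) →
      (∀ β ∈ posRoots S v, (l.map reflIso).prod β ∈ posRoots S v) →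
      (l.map reflIso).prod = 1 := by
  induction n using Nat.strong_induction_on with
  | _ n ih =>
    intro l hn hl hP
    rcases l.eq_nil_or_concat with rfl | ⟨m, a, rfl⟩
    · simp
    · simp only [List.concat_eq_append, List.mem_append, List.mem_singleton] at hl
      have ha := hl a (Or.inr rfl)
      have haP := posRoots_of_mem_simpleRoots ha
      have hprod : ((m.concat a).map reflIso).prod = (m.map reflIso).prod * reflIso a := by simp
      have hma : (m.map reflIso).prod a ∉ posRoots S v := by
        intro hc
        have := hP a haP
        rw [hprod] at this
        have h2 : ((m.map reflIso).prod * reflIso a) a = -((m.map reflIso).prod a) := by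
          change (m.map reflIso).prod (reflIso a a) = _
          rw [reflIso_self, map_neg]
        rw [h2] at this
        have h3 := (mem_posRoots.1 this).2
        have h4 := (mem_posRoots.1 hc).2
        rw [inner_neg_left] at h3
        linarith
      obtain ⟨k, hk, hlen, hkp⟩ := hS.exchange hv haP m (fun α h => hl α (Or.inl h)) hma
      rw [hprod, hkp] at hP ⊢
      simp at hn
      exact ih k.length (by omega) k rfl hk hP

/-- The Weyl group acts freely on regular vectors. -/
lemma eq_one_of_fixes_regular (hS : IsRootSet S) (hv : ∀ α ∈ S, ⟪α, v⟫ ≠ 0)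
    {w : E d ≃ₗᵢ[ℝ] E d} (hw : w ∈ weylGroup S) (hfix : w v = v) : w = 1 := by
  obtain ⟨l, hl, rfl⟩ := hS.exists_list_prod hv w hw
  refine hS.list_prod_eq_one hv _ l rfl hl fun β hβ => mem_posRoots.2 ⟨?_, ?_⟩
  · exact hS.map_mem hw β (mem_posRoots.1 hβ).1
  · have := (l.map reflIso).prod.inner_map_map β v
    rw [hfix] at this
    rw [this]; exact (mem_posRoots.1 hβ).2

end IsRootSet

lemma eventually_inner_ne_zero {d : ℕ} (S : Finset (E d)) {x u : E d}
    (h : ∀ α ∈ S, ⟪α, x⟫ = 0 → ⟪α, u⟫ ≠ 0) :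
    ∀ᶠ ε : ℝ in 𝓝[≠] 0, ∀ α ∈ S, ⟪α, x + ε • u⟫ ≠ 0 := by
  rw [Finset.eventually_all]
  intro α hα
  by_cases hx : ⟪α, x⟫ = 0
  · filter_upwards [self_mem_nhdsWithin] with ε hε
    rw [inner_add_right, inner_smul_right, hx, zero_add]
    exact mul_ne_zero hε (h α hα hx)
  · refine nhdsWithin_le_nhds ?_
    have hc : Continuous fun ε : ℝ => ⟪α, x + ε • u⟫ := by fun_prop
    exact hc.continuousAt.eventually_ne (by simpa using hx)

lemma dsign_mul_self {d : ℕ} (w : E d ≃ₗᵢ[ℝ] E d) : dsign w * dsign w = 1 := by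
  have : |dsign w| = 1 :=
    (LinearMap.normDet_eq_abs_det _).symm.trans (LinearIsometry.normDet_eq_one w.toLinearIsometry)
  rw [← abs_mul_abs_self, this, one_mul]

/-- The sum of the positive roots. -/
def posSum {d : ℕ} (S : Finset (E d)) (v : E d) : E d := ∑ α ∈ posRoots S v, α

/-- The alternating sum of exponentials over the Weyl group orbit of `μ`. -/
def altExp {d : ℕ} (S : Finset (E d)) [Fintype (weylGroup S)] (μ X : E d) : ℝ :=
  ∑ w : weylGroup S, dsign w.1 * Real.exp ⟪w.1 μ, X⟫

lemma altExp_map {d : ℕ} {S : Finset (E d)} [Fintype (weylGroup S)] {u : E d ≃ₗᵢ[ℝ] E d}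
    (hu : u ∈ weylGroup S) (μ X : E d) : altExp S (u μ) X = dsign u * altExp S μ X := by
  rw [altExp, altExp, mul_sum]
  refine Fintype.sum_equiv (Equiv.mulRight (⟨u, hu⟩ : weylGroup S)) _ _ fun w => ?_
  have : dsign w.1 = dsign u * dsign (w.1 * u) := by
    rw [dsign_mul, mul_left_comm, dsign_mul_self, mul_one]
  rw [this, mul_assoc]
  rfl

namespace IsRootSet

variable {d : ℕ} {S : Finset (E d)} {v : E d}

lemma altExp_eq_zero (hS : IsRootSet S) [Fintype (weylGroup S)] {α μ : E d} (hα : α ∈ S)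
    (h : ⟪α, μ⟫ = 0) (X : E d) : altExp S μ X = 0 := by
  have := altExp_map (reflIso_mem_weylGroup hα) μ X
  rw [reflIso_eq_of_inner_eq_zero h, dsign_reflIso (hS.ne_zero hα)] at this
  linarith

@[to_additive]
lemma prod_erase_reflIso (hS : IsRootSet S) (hv : ∀ α ∈ S, ⟪α, v⟫ ≠ 0) {α : E d}
    (hα : α ∈ simpleRoots S v) {M : Type*} [CommMonoid M] (f : E d → M) :
    ∏ β ∈ (posRoots S v).erase α, f (reflIso α β) = ∏ β ∈ (posRoots S v).erase α, f β := by
  have hmem : ∀ β ∈ (posRoots S v).erase α, reflIso α β ∈ (posRoots S v).erase α := by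
    intro β hβ
    rw [mem_erase] at hβ ⊢
    refine ⟨fun h => ?_, hS.reflIso_mem_posRoots hv hα β hβ.2 hβ.1⟩
    have h2 : β = -α := by rw [← reflIso_self, ← reflIso_reflIso α β, h]
    have h3 := (mem_posRoots.1 hβ.2).2
    have h4 := (mem_posRoots.1 (posRoots_of_mem_simpleRoots hα)).2
    rw [h2, inner_neg_left] at h3
    linarith
  exact prod_nbij' (reflIso α) (reflIso α) hmem hmem (fun β _ => reflIso_reflIso α β)
    (fun β _ => reflIso_reflIso α β) (fun β _ => rfl)

lemma prod_odd_map (hS : IsRootSet S) (hv : ∀ α ∈ S, ⟪α, v⟫ ≠ 0) {g : ℝ → ℝ}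
    (hg : ∀ t, g (-t) = -g t) :
    ∀ w ∈ weylGroup S, ∀ X : E d,
      ∏ α ∈ posRoots S v, g ⟪α, w X⟫ = dsign w * ∏ α ∈ posRoots S v, g ⟪α, X⟫ := by
  refine hS.weylGroup_induction hv (by simp [dsign_one]) fun α hα w _ ih X => ?_
  have hαP := posRoots_of_mem_simpleRoots hα
  rw [dsign_mul, dsign_reflIso (hS.ne_zero (mem_posRoots.1 hαP).1), mul_assoc, ← ih X,
    ← mul_prod_erase _ _ hαP, ← mul_prod_erase _ (fun β => g ⟪β, w X⟫) hαP,
    ← hS.prod_erase_reflIso hv hα (fun β => g ⟪β, w X⟫)]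
  have h1 : ∀ β, ⟪β, (reflIso α * w) X⟫ = ⟪reflIso α β, w X⟫ := fun β =>
    (inner_map_reflIso α β (w X)).symm
  simp_rw [h1, reflIso_self, inner_neg_left, hg]
  ring

lemma sum_abs_map (hS : IsRootSet S) (hv : ∀ α ∈ S, ⟪α, v⟫ ≠ 0) :
    ∀ w ∈ weylGroup S, ∀ X : E d,
      ∑ α ∈ posRoots S v, |⟪α, w X⟫| = ∑ α ∈ posRoots S v, |⟪α, X⟫| := by
  refine hS.weylGroup_induction hv (by simp) fun α hα w _ ih X => ?_
  have hαP := posRoots_of_mem_simpleRoots hα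
  rw [← ih X, ← add_sum_erase _ _ hαP, ← add_sum_erase _ (fun β => |⟪β, w X⟫|) hαP,
    ← hS.sum_erase_reflIso hv hα (fun β => |⟪β, w X⟫|)]
  have h1 : ∀ β, ⟪β, (reflIso α * w) X⟫ = ⟪reflIso α β, w X⟫ := fun β =>
    (inner_map_reflIso α β (w X)).symm
  simp_rw [h1, reflIso_self, inner_neg_left, abs_neg]

lemma reflIso_posSum (hS : IsRootSet S) (hv : ∀ α ∈ S, ⟪α, v⟫ ≠ 0) {α : E d}
    (hα : α ∈ simpleRoots S v) : reflIso α (posSum S v) = posSum S v - α - α := by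
  have hαP := posRoots_of_mem_simpleRoots hα
  have h := hS.sum_erase_reflIso hv hα (fun β => β)
  rw [posSum, map_sum, ← add_sum_erase _ _ hαP, ← add_sum_erase _ (fun β => β) hαP, h,
    reflIso_self]
  abel

lemma inner_simple_posSum (hS : IsRootSet S) (hv : ∀ α ∈ S, ⟪α, v⟫ ≠ 0) {α : E d}
    (hα : α ∈ simpleRoots S v) : ⟪α, posSum S v⟫ = ⟪α, α⟫ := by
  have := inner_map_reflIso α α (posSum S v)
  rw [hS.reflIso_posSum hv hα, reflIso_self, inner_neg_left, inner_sub_right, inner_sub_right]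
    at this
  linarith

lemma inner_posSum_pos (hS : IsRootSet S) (hv : ∀ α ∈ S, ⟪α, v⟫ ≠ 0) :
    ∀ α ∈ posRoots S v, 0 < ⟪α, posSum S v⟫ := by
  refine posRoots_induction _ (fun α hα => ?_) fun β _ γ _ h1 h2 => ?_
  · rw [hS.inner_simple_posSum hv hα]
    exact hS.inner_self_pos (mem_posRoots.1 (posRoots_of_mem_simpleRoots hα)).1
  · rw [inner_add_left]; exact add_pos h1 h2

lemma inner_posSum_ne_zero (hS : IsRootSet S) (hv : ∀ α ∈ S, ⟪α, v⟫ ≠ 0) :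
    ∀ α ∈ S, ⟪α, posSum S v⟫ ≠ 0 := by
  intro α hα
  rcases hS.posRoots_or_neg hv hα with h | h
  · exact (hS.inner_posSum_pos hv α h).ne'
  · have := hS.inner_posSum_pos hv _ h
    rw [inner_neg_left] at this
    linarith

/-- Every vector has a dominant Weyl group translate. -/
lemma exists_dominant (hS : IsRootSet S) (v : E d) [Finite (weylGroup S)]
    (x : E d) : ∃ w ∈ weylGroup S, ∀ α ∈ posRoots S v, 0 ≤ ⟪α, w x⟫ := by
  obtain ⟨w, hw⟩ := Finite.exists_max fun w : weylGroup S => ⟪w.1 x, v⟫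
  refine ⟨w.1, w.2, fun α hα => ?_⟩
  by_contra! hneg
  have hαS := (mem_posRoots.1 hα).1
  have h1 := hw (⟨reflIso α, reflIso_mem_weylGroup hαS⟩ * w)
  have h2 : ((⟨reflIso α, reflIso_mem_weylGroup hαS⟩ * w : weylGroup S).1) x =
      reflIso α (w.1 x) := rfl
  rw [h2, reflIso_apply, reflVec, inner_sub_left, inner_smul_left] at h1
  have h3 : 2 * ⟪α, w.1 x⟫ / ⟪α, α⟫ < 0 :=
    div_neg_of_neg_of_pos (by linarith) (hS.inner_self_pos hαS)
  have h4 := (mem_posRoots.1 hα).2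
  simp only [conj_trivial] at h1
  nlinarith

lemma map_mem_rootLattice (hS : IsRootSet S) {w : E d ≃ₗᵢ[ℝ] E d} (hw : w ∈ weylGroup S)
    {x : E d} (hx : x ∈ AddSubgroup.closure (S : Set (E d))) :
    w x ∈ AddSubgroup.closure (S : Set (E d)) := by
  induction hx using AddSubgroup.closure_induction with
  | mem y hy => exact AddSubgroup.subset_closure (hS.map_mem hw y hy)
  | zero => rw [map_zero]; exact zero_mem _
  | add y z _ _ h1 h2 => rw [map_add]; exact add_mem h1 h2
  | neg y _ h1 => rw [map_neg]; exact AddSubgroup.neg_mem _ h1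

lemma exists_int_of_mem_rootLattice (hS : IsRootSet S) {x : E d}
    (hx : x ∈ AddSubgroup.closure (S : Set (E d))) {α : E d} (hα : α ∈ S) :
    ∃ z : ℤ, 2 * ⟪x, α⟫ / ⟪α, α⟫ = z := by
  induction hx using AddSubgroup.closure_induction with
  | mem y hy => exact hS.crystallographic y hy α hα
  | zero => exact ⟨0, by simp⟩
  | add y z _ _ h1 h2 =>
    obtain ⟨a, ha⟩ := h1
    obtain ⟨b, hb⟩ := h2
    exact ⟨a + b, by rw [Int.cast_add, ← ha, ← hb, inner_add_left]; ring⟩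
  | neg y _ h1 =>
    obtain ⟨a, ha⟩ := h1
    exact ⟨-a, by rw [Int.cast_neg, ← ha, inner_neg_left]; ring⟩

lemma half_posSum_sub_mem (hS : IsRootSet S) (hv : ∀ α ∈ S, ⟪α, v⟫ ≠ 0) :
    ∀ w ∈ weylGroup S, (2⁻¹ : ℝ) • posSum S v - w ((2⁻¹ : ℝ) • posSum S v) ∈
      AddSubgroup.closure (S : Set (E d)) := by
  refine hS.weylGroup_induction hv (by simp [zero_mem]) fun α hα w _ ih => ?_
  have hαS := (mem_posRoots.1 (posRoots_of_mem_simpleRoots hα)).1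
  have h1 := hS.map_mem_rootLattice (reflIso_mem_weylGroup hαS) ih
  have h2 : (2⁻¹ : ℝ) • posSum S v - (reflIso α * w) ((2⁻¹ : ℝ) • posSum S v) =
      reflIso α ((2⁻¹ : ℝ) • posSum S v - w ((2⁻¹ : ℝ) • posSum S v)) + α := by
    rw [map_sub, map_smul (reflIso α), hS.reflIso_posSum hv hα]
    have h3 : (reflIso α * w) ((2⁻¹ : ℝ) • posSum S v) = reflIso α (w ((2⁻¹ : ℝ) • posSum S v)) :=
      rfl
    rw [h3]
    module
  rw [h2]
  exact add_mem h1 (AddSubgroup.subset_closure hαS)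

/-- An exponent occurring in the Weyl denominator is either singular or conjugate to the half sum
of positive roots. -/
lemma altExp_eq_zero_or_exists (hS : IsRootSet S) (hv : ∀ α ∈ S, ⟪α, v⟫ ≠ 0)
    [Fintype (weylGroup S)] {t : Finset (E d)} (ht : t ⊆ posRoots S v) :
    (∀ X, altExp S ((2⁻¹ : ℝ) • (∑ α ∈ t, α - ∑ α ∈ posRoots S v \ t, α)) X = 0) ∨
    ∃ w ∈ weylGroup S, w ((2⁻¹ : ℝ) • (∑ α ∈ t, α - ∑ α ∈ posRoots S v \ t, α)) =
      (2⁻¹ : ℝ) • posSum S v := by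
  set μ := (2⁻¹ : ℝ) • (∑ α ∈ t, α - ∑ α ∈ posRoots S v \ t, α) with hμ
  obtain ⟨w, hw, hdom⟩ := hS.exists_dominant v μ
  by_cases hsing : ∃ α ∈ posRoots S v, ⟪α, w μ⟫ = 0
  · left
    obtain ⟨α, hα, h0⟩ := hsing
    intro X
    have h1 := hS.altExp_eq_zero (mem_posRoots.1 hα).1 h0 X
    rw [altExp_map hw] at h1
    rcases mul_eq_zero.1 h1 with h | h
    · have := dsign_mul_self w
      rw [h] at this; simp at this
    · exact h
  · right
    push Not at hsing
    refine ⟨w, hw, ?_⟩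
    set δ := (2⁻¹ : ℝ) • posSum S v - w μ with hδ
    have hsum : posSum S v = ∑ α ∈ posRoots S v \ t, α + ∑ α ∈ t, α :=
      (sum_sdiff ht).symm
    have hlat : δ ∈ AddSubgroup.closure (S : Set (E d)) := by
      have h1 : δ = ((2⁻¹ : ℝ) • posSum S v - w ((2⁻¹ : ℝ) • posSum S v)) +
          w (∑ α ∈ posRoots S v \ t, α) := by
        have : μ = (2⁻¹ : ℝ) • posSum S v - ∑ α ∈ posRoots S v \ t, α := by
          rw [hμ, hsum]; module
        rw [hδ, this, map_sub]; abel
      rw [h1]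
      refine add_mem (hS.half_posSum_sub_mem hv w hw) (hS.map_mem_rootLattice hw ?_)
      exact sum_mem fun α hα =>
        AddSubgroup.subset_closure (mem_posRoots.1 (mem_sdiff.1 hα).1).1
    have hdual : ∀ z, (∀ α ∈ posRoots S v, 0 ≤ ⟪α, z⟫) → 0 ≤ ⟪δ, z⟫ := by
      intro z hz
      have h1 : ⟪w μ, z⟫ = ⟪μ, w⁻¹ z⟫ := by
        rw [real_inner_comm, ← inner_map_inv, real_inner_comm]
      have h2 := hS.sum_abs_map hv w⁻¹ (inv_mem hw) z
      have h3 : ∑ α ∈ posRoots S v, |⟪α, z⟫| = ⟪posSum S v, z⟫ := by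
        rw [posSum, sum_inner]
        exact sum_congr rfl fun α hα => abs_of_nonneg (hz α hα)
      have h4 : ∑ α ∈ t, ⟪α, w⁻¹ z⟫ ≤ ∑ α ∈ t, |⟪α, w⁻¹ z⟫| :=
        sum_le_sum fun α _ => le_abs_self _
      have h5 : -∑ α ∈ posRoots S v \ t, ⟪α, w⁻¹ z⟫ ≤ ∑ α ∈ posRoots S v \ t, |⟪α, w⁻¹ z⟫| := by
        rw [← sum_neg_distrib]
        exact sum_le_sum fun α _ => neg_le_abs _
      rw [← sum_sdiff ht, h3] at h2
      rw [hδ, inner_sub_left, h1, hμ, real_inner_smul_left, real_inner_smul_left, inner_sub_left,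
        sum_inner, sum_inner]
      linarith
    have hsimple : ∀ α ∈ simpleRoots S v, ⟪α, δ⟫ ≤ 0 := by
      intro α hα
      have hαP := posRoots_of_mem_simpleRoots hα
      have hαS := (mem_posRoots.1 hαP).1
      have hpos := hS.inner_self_pos hαS
      obtain ⟨z, hz⟩ := hS.exists_int_of_mem_rootLattice hlat hαS
      rw [div_eq_iff hpos.ne'] at hz
      have h1 : ⟪δ, α⟫ = 2⁻¹ * ⟪α, α⟫ - ⟪α, w μ⟫ := by
        rw [hδ, inner_sub_left, real_inner_smul_left, real_inner_comm, 
          hS.inner_simple_posSum hv hα, real_inner_comm (w μ)]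
      have h2 : 0 < ⟪α, w μ⟫ := lt_of_le_of_ne (hdom α hαP) (hsing α hαP).symm
      have h3 : z < 1 := by
        have : (z : ℝ) < 1 := by
          by_contra! hc
          nlinarith
        exact_mod_cast this
      have h4 : (z : ℝ) ≤ 0 := by exact_mod_cast Int.lt_add_one_iff.1 h3
      rw [real_inner_comm]
      nlinarith
    have h0 := hdual (-δ) fun α hα => by
      by_contra! hc
      rw [inner_neg_right] at hc
      obtain ⟨β, hβ, hβ'⟩ := exists_simpleRoots_inner_pos hα (y := δ) (by linarith)
      exact absurd (hsimple β hβ) (not_le.2 hβ')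
    rw [inner_neg_right] at h0
    have h1 : δ = 0 := by
      rw [← real_inner_self_nonpos]; linarith
    exact (sub_eq_zero.1 h1).symm

lemma inner_map_posSum_lt (hS : IsRootSet S) (hv : ∀ α ∈ S, ⟪α, v⟫ ≠ 0)
    {w : E d ≃ₗᵢ[ℝ] E d} (hw : w ∈ weylGroup S) (h1 : w ≠ 1) :
    ⟪w (posSum S v), posSum S v⟫ < ⟪posSum S v, posSum S v⟫ := by
  have hne : w (posSum S v) - posSum S v ≠ 0 := fun h =>
    h1 (hS.eq_one_of_fixes_regular (hS.inner_posSum_ne_zero hv) hw (sub_eq_zero.1 h))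
  have h2 := real_inner_self_pos.2 hne
  rw [inner_sub_left, inner_sub_right, inner_sub_right, w.inner_map_map,
    real_inner_comm (w (posSum S v))] at h2
  linarith

/-- Weyl's denominator formula. -/
theorem weyl_denominator (hS : IsRootSet S) (hv : ∀ α ∈ S, ⟪α, v⟫ ≠ 0) [Fintype (weylGroup S)]
    (X : E d) :
    ∏ α ∈ posRoots S v, (Real.exp (⟪α, X⟫ / 2) - Real.exp (-⟪α, X⟫ / 2)) =
      altExp S ((2⁻¹ : ℝ) • posSum S v) X := by
  set ρ := posSum S v with hρ
  set D : E d → ℝ := fun X => ∏ α ∈ posRoots S v, (Real.exp (⟪α, X⟫ / 2) - Real.exp (-⟪α, X⟫ / 2))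
    with hD
  set m : Finset (E d) → E d := fun t =>
    (2⁻¹ : ℝ) • (∑ α ∈ t, α - ∑ α ∈ posRoots S v \ t, α) with hm
  have hexpand : ∀ X, D X = ∑ t ∈ (posRoots S v).powerset,
      (-1) ^ (#(posRoots S v \ t)) * Real.exp ⟪m t, X⟫ := by
    intro X
    simp only [hD, sub_eq_add_neg]
    rw [prod_add]
    refine sum_congr rfl fun t _ => ?_
    rw [prod_neg, ← Real.exp_sum, ← Real.exp_sum, mul_left_comm, ← Real.exp_add]
    congr 2
    simp only [hm, real_inner_smul_left, inner_sub_left, sum_inner, ← sum_div, sum_neg_distrib]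
    ring
  have hskew : ∀ (w : weylGroup S) (X), dsign w.1 * D ((w.1)⁻¹ X) = D X := by
    intro w X
    have h1 := hS.prod_odd_map hv (g := fun t => Real.exp (t / 2) - Real.exp (-t / 2))
      (fun t => by simp) w.1 w.2 ((w.1)⁻¹ X)
    have h2 : w.1 ((w.1)⁻¹ X) = X := w.1.apply_symm_apply X
    rw [h2] at h1
    exact h1.symm
  have hkappa : ∀ t ∈ (posRoots S v).powerset, ∃ κ : ℝ, ∀ X,
      altExp S (m t) X = κ * altExp S ((2⁻¹ : ℝ) • ρ) X := by
    intro t ht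
    rcases hS.altExp_eq_zero_or_exists hv (mem_powerset.1 ht) with h | ⟨w, hw, h⟩
    · exact ⟨0, fun X => by rw [h, zero_mul]⟩
    · refine ⟨dsign w, fun X => ?_⟩
      rw [← h, altExp_map hw, ← mul_assoc, dsign_mul_self, one_mul]
  choose! κ hκ using hkappa
  obtain ⟨K, hK⟩ : ∃ K : ℝ, ∀ X, D X = K * altExp S ((2⁻¹ : ℝ) • ρ) X := by
    refine ⟨(Fintype.card (weylGroup S) : ℝ)⁻¹ * ∑ t ∈ (posRoots S v).powerset,
      (-1) ^ (#(posRoots S v \ t)) * κ t, fun X => ?_⟩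
    have h1 : (Fintype.card (weylGroup S) : ℝ) * D X = ∑ w : weylGroup S,
        dsign w.1 * D ((w.1)⁻¹ X) := by
      simp_rw [hskew, sum_const, nsmul_eq_mul, card_univ]
    have h2 : ∑ w : weylGroup S, dsign w.1 * D ((w.1)⁻¹ X) =
        ∑ t ∈ (posRoots S v).powerset, (-1) ^ (#(posRoots S v \ t)) * altExp S (m t) X := by
      simp only [hexpand, mul_sum, altExp]
      rw [sum_comm]
      refine sum_congr rfl fun t _ => sum_congr rfl fun w _ => ?_
      have : ⟪m t, (w.1)⁻¹ X⟫ = ⟪w.1 (m t), X⟫ := by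
        rw [real_inner_comm, inner_map_inv, real_inner_comm]
      rw [this]; ring
    rw [mul_assoc, eq_inv_mul_iff_mul_eq₀ (by simp), h1, h2, sum_mul]
    exact sum_congr rfl fun t ht => by rw [hκ t ht]; ring
  have hlimD : Tendsto (fun s : ℝ => Real.exp (-(s * (2⁻¹ * ⟪ρ, ρ⟫))) * D (s • ρ)) atTop (𝓝 1) := by
    have h1 : ∀ s : ℝ, Real.exp (-(s * (2⁻¹ * ⟪ρ, ρ⟫))) * D (s • ρ) =
        ∏ α ∈ posRoots S v, (1 - Real.exp (-(⟪α, ρ⟫ * s))) := by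
      intro s
      have h2 : -(s * (2⁻¹ * ⟪ρ, ρ⟫)) = ∑ α ∈ posRoots S v, -(s * ⟪α, ρ⟫ / 2) := by
        have : ⟪ρ, ρ⟫ = ∑ α ∈ posRoots S v, ⟪α, ρ⟫ := by
          conv_lhs => rw [hρ, posSum, sum_inner]
          rfl
        rw [this, mul_sum, mul_sum, sum_neg_distrib]
        congr 1
        exact sum_congr rfl fun α _ => by ring
      rw [h2, Real.exp_sum, ← prod_mul_distrib]
      refine prod_congr rfl fun α _ => ?_
      rw [mul_sub, ← Real.exp_add, ← Real.exp_add, real_inner_smul_right]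
      congr 1
      · rw [Real.exp_eq_one_iff]; ring
      · congr 1; ring
    simp only [h1]
    have h3 : Tendsto (fun s : ℝ => ∏ α ∈ posRoots S v, (1 - Real.exp (-(⟪α, ρ⟫ * s)))) atTop
        (𝓝 (∏ α ∈ posRoots S v, ((1 : ℝ) - 0))) :=
      tendsto_finsetProd _ fun α hα => tendsto_const_nhds.sub
        (Real.tendsto_exp_neg_atTop_nhds_zero.comp
          (tendsto_id.const_mul_atTop (hS.inner_posSum_pos hv α hα)))
    simpa using h3
  have hlimA : Tendsto (fun s : ℝ => Real.exp (-(s * (2⁻¹ * ⟪ρ, ρ⟫))) *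
      altExp S ((2⁻¹ : ℝ) • ρ) (s • ρ)) atTop (𝓝 1) := by
    have h1 : ∀ s : ℝ, Real.exp (-(s * (2⁻¹ * ⟪ρ, ρ⟫))) * altExp S ((2⁻¹ : ℝ) • ρ) (s • ρ) =
        ∑ w : weylGroup S, dsign w.1 *
          Real.exp (-((2⁻¹ * (⟪ρ, ρ⟫ - ⟪w.1 ρ, ρ⟫)) * s)) := by
      intro s
      rw [altExp, mul_sum]
      refine sum_congr rfl fun w _ => ?_
      rw [mul_left_comm, ← Real.exp_add, map_smul, real_inner_smul_left, real_inner_smul_right]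
      congr 2; ring
    simp only [h1]
    have h2 : (1 : ℝ) = ∑ w : weylGroup S, if w = 1 then 1 else 0 := by simp
    rw [h2]
    refine tendsto_finsetSum _ fun w _ => ?_
    split_ifs with hw
    · subst hw
      simp [dsign_one]
    · rw [← mul_zero (dsign w.1)]
      refine tendsto_const_nhds.mul (Real.tendsto_exp_neg_atTop_nhds_zero.comp
        (tendsto_id.const_mul_atTop ?_))
      have := hS.inner_map_posSum_lt hv w.2 (fun h => hw (Subtype.ext h))
      rw [← hρ] at this
      linarith
  have hK1 : K = 1 := by
    have h1 := hlimA.const_mul K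
    rw [mul_one] at h1
    refine tendsto_nhds_unique (h1.congr fun s => ?_) hlimD
    rw [hK]; ring
  rw [← one_mul (altExp S _ X), ← hK1]
  exact hK X

/-- The roots orthogonal to `y` form a root system. -/
lemma filter_orthogonal (hS : IsRootSet S) (y : E d) :
    IsRootSet (S.filter (fun α => ⟪α, y⟫ = 0)) where
  zero_notMem h := hS.zero_notMem (mem_filter.1 h).1
  reduced α hα t ht := hS.reduced α (mem_filter.1 hα).1 t (mem_filter.1 ht).1
  reflIso_mem α hα β hβ := by
    rw [mem_filter] at hα hβ ⊢
    refine ⟨hS.reflIso_mem α hα.1 β hβ.1, ?_⟩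
    rw [inner_map_reflIso, reflIso_eq_of_inner_eq_zero hα.2, hβ.2]
  crystallographic α hα β hβ :=
    hS.crystallographic α (mem_filter.1 hα).1 β (mem_filter.1 hβ).1

lemma weylGroup_filter_le (S : Finset (E d)) (y : E d) :
    weylGroup (S.filter (fun α => ⟪α, y⟫ = 0)) ≤ weylGroup S := by
  rw [weylGroup_eq, Subgroup.closure_le]
  rintro _ ⟨α, hα, rfl⟩
  exact reflIso_mem_weylGroup (mem_filter.1 hα).1

/-- The stabilizer of `y` in the Weyl group is generated by the reflections fixing `y`. -/
theorem mem_weylGroup_filter_iff (hS : IsRootSet S) (hv : ∀ α ∈ S, ⟪α, v⟫ ≠ 0)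
    [Finite (weylGroup S)] (y : E d) {w : E d ≃ₗᵢ[ℝ] E d} (hw : w ∈ weylGroup S) :
    w ∈ weylGroup (S.filter (fun α => ⟪α, y⟫ = 0)) ↔ w y = y := by
  set T := S.filter (fun α => ⟪α, y⟫ = 0) with hT
  have hfix : ∀ u ∈ weylGroup T, u y = y := by
    intro u hu
    rw [weylGroup_eq] at hu
    induction hu using Subgroup.closure_induction_left with
    | one => rfl
    | mul_left x hx z hz ih =>
      obtain ⟨α, hα, rfl⟩ := hx
      change reflIso α (z y) = y
      rw [ih, reflIso_eq_of_inner_eq_zero (mem_filter.1 hα).2]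
    | inv_mul_cancel x hx z hz ih =>
      obtain ⟨α, hα, rfl⟩ := hx
      rw [reflIso_inv]
      change reflIso α (z y) = y
      rw [ih, reflIso_eq_of_inner_eq_zero (mem_filter.1 hα).2]
  refine ⟨hfix w, fun hwy => ?_⟩
  have hTS : IsRootSet T := hS.filter_orthogonal y
  have hvT : ∀ α ∈ T, ⟪α, v⟫ ≠ 0 := fun α hα => hv α (mem_filter.1 hα).1
  have : Finite (weylGroup T) :=
    Finite.of_injective _ (Subgroup.inclusion_injective (weylGroup_filter_le S y))
  obtain ⟨u, hu, hdom⟩ := hTS.exists_dominant v (w (posSum T v))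
  have huS := weylGroup_filter_le S y hu
  set g := u * w with hg
  have hgS : g ∈ weylGroup S := mul_mem huS hw
  have hgy : g y = y := by
    change u (w y) = y
    rw [hwy, hfix u hu]
  have hgT : ∀ α ∈ T, g⁻¹ α ∈ T := by
    intro α hα
    rw [hT, mem_filter] at hα ⊢
    exact ⟨hS.map_mem (inv_mem hgS) α hα.1, by rw [inner_map_inv, hgy, hα.2]⟩
  have hinv : ∀ α ∈ posRoots T v, g⁻¹ α ∈ posRoots T v := by
    intro α hα
    have h1 := hdom α hα
    have h2 := hgT α (mem_posRoots.1 hα).1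
    by_contra hc
    have h3 := hTS.inner_posSum_pos hvT _ (hTS.neg_mem_posRoots hvT h2 hc)
    rw [inner_neg_left, inner_map_inv] at h3
    change 0 ≤ ⟪α, g (posSum T v)⟫ at h1
    linarith
  have hsum : g⁻¹ (posSum T v) = posSum T v := by
    rw [posSum, map_sum]
    have himg : (posRoots T v).image (g⁻¹ : E d ≃ₗᵢ[ℝ] E d) = posRoots T v := by
      refine eq_of_subset_of_card_le (image_subset_iff.2 hinv) ?_
      rw [card_image_of_injective _ (g⁻¹ : E d ≃ₗᵢ[ℝ] E d).injective]
    conv_rhs => rw [← himg]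
    rw [sum_image fun a _ b _ h => (g⁻¹ : E d ≃ₗᵢ[ℝ] E d).injective h]
  obtain ⟨ε, hε⟩ := (eventually_inner_ne_zero S (x := y) (u := posSum T v) fun α hα h0 =>
    hTS.inner_posSum_ne_zero hvT α (mem_filter.2 ⟨hα, h0⟩)).exists
  have hg1 : g⁻¹ = 1 := by
    refine hS.eq_one_of_fixes_regular hε (inv_mem hgS) ?_
    have h1 : g⁻¹ y = y := by
      conv_lhs => rw [← hgy]
      exact g.symm_apply_apply y
    rw [map_add, map_smul, hsum, h1]
  have : w = u⁻¹ := by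
    rw [eq_inv_iff_mul_eq_one, ← inv_eq_one, mul_inv_rev] 
    rw [inv_eq_one, hg] at hg1
    rw [eq_inv_of_mul_eq_one_right hg1]; simp
  rw [this]
  exact inv_mem hu

end IsRootSet

lemma contDiff_integral_zero_one {V : Type*} [NormedAddCommGroup V] [NormedSpace ℝ V]
    {H : V × ℝ → ℝ} (hH : ContDiff ℝ ∞ H) : ContDiff ℝ ∞ fun x => ∫ t in (0 : ℝ)..1, H (x, t) := by
  let χ : ContDiffBump (0 : ℝ) := ⟨1, 2, one_pos, one_lt_two⟩
  have key := MeasureTheory.contDiffOn_convolution_right_with_param_comp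
    (μ := MeasureTheory.volume) (n := ⊤)
    (ContinuousLinearMap.mul ℝ ℝ) (s := (Set.univ : Set V)) (v := fun _ => (0 : ℝ))
    contDiffOn_const (f := (Set.Ioc (0 : ℝ) 1).indicator 1)
    (g := fun x s => χ s * H (x, -s)) (k := Metric.closedBall 0 2) isOpen_univ
    (isCompact_closedBall _ _)
    (fun p x _ hx => by
      have : χ x = 0 := χ.zero_of_le_dist (not_le.1 hx).le
      simp [this])
    (by
      refine MeasureTheory.Integrable.locallyIntegrable ?_
      rw [MeasureTheory.integrable_indicator_iff measurableSet_Ioc]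
      exact MeasureTheory.integrableOn_const (by simp) (by simp))
    (by
      refine ContDiff.contDiffOn ?_
      have h1 : ContDiff ℝ ∞ fun q : V × ℝ => χ q.2 := χ.contDiff.comp contDiff_snd
      exact h1.mul (hH.comp (contDiff_fst.prodMk contDiff_snd.neg)))
  rw [contDiffOn_univ] at key
  convert key using 2 with x
  rw [intervalIntegral.integral_of_le zero_le_one,
    ← MeasureTheory.integral_indicator measurableSet_Ioc]
  refine MeasureTheory.integral_congr_ae (Eventually.of_forall fun t => ?_)
  by_cases ht : t ∈ Set.Ioc (0 : ℝ) 1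
  · have : χ (-t) = 1 := χ.one_of_mem_closedBall (by
      simp only [Metric.mem_closedBall, dist_zero_right, norm_neg, Real.norm_eq_abs]
      rw [abs_of_pos ht.1]; exact ht.2)
    simp [ht, this]
  · simp [ht]

lemma exists_contDiff_eventuallyEq {V : Type*} [NormedAddCommGroup V] [NormedSpace ℝ V]
    [FiniteDimensional ℝ V] {U : Set V} (hU : IsOpen U) {F : V → ℝ} (hF : ContDiffOn ℝ ∞ F U)
    {x : V} (hx : x ∈ U) : ∃ G : V → ℝ, ContDiff ℝ ∞ G ∧ G =ᶠ[𝓝 x] F := by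
  obtain ⟨r, hr, hrU⟩ := Metric.nhds_basis_closedBall.mem_iff.1 (hU.mem_nhds hx)
  let χ : ContDiffBump x := ⟨r / 2, r, half_pos hr, half_lt_self hr⟩
  refine ⟨fun y => χ y * F y, ?_, ?_⟩
  · refine contDiff_iff_contDiffAt.2 fun y => ?_
    by_cases hy : y ∈ tsupport fun y => χ y * F y
    swap
    · exact contDiffAt_const.congr_of_eventuallyEq (notMem_tsupport_iff_eventuallyEq.1 hy)
    have hyU : y ∈ U := by
      have := tsupport_mul_subset_left hy
      rw [χ.tsupport_eq] at this
      exact hrU this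
    exact χ.contDiff.contDiffAt.mul (hF.contDiffAt (hU.mem_nhds hyU))
  · filter_upwards [χ.eventuallyEq_one] with y hy
    simp [hy]

/-- A smooth function vanishing on a hyperplane is divisible by the equation of the hyperplane. -/
lemma exists_contDiffOn_div {V : Type*} [NormedAddCommGroup V] [NormedSpace ℝ V]
    [FiniteDimensional ℝ V] {U : Set V} (hU : IsOpen U) {F : V → ℝ} (hF : ContDiffOn ℝ ∞ F U)
    {l : V →L[ℝ] ℝ} (hl : l ≠ 0) (hzero : ∀ x ∈ U, l x = 0 → F x = 0) :
    ∃ G : V → ℝ, ContDiffOn ℝ ∞ G U ∧ ∀ x ∈ U, F x = l x * G x := by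
  obtain ⟨v, hv⟩ : ∃ v, l v = 1 := by
    obtain ⟨v, hv⟩ := DFunLike.ne_iff.1 hl
    exact ⟨(l v)⁻¹ • v, by rw [map_smul, smul_eq_mul, inv_mul_cancel₀ hv]⟩
  refine ⟨fun x => if l x = 0 then fderiv ℝ F x v else F x / l x, ?_, fun x hx => ?_⟩
  · intro x₀ hx₀
    refine ContDiffAt.contDiffWithinAt ?_
    by_cases h0 : l x₀ = 0
    · obtain ⟨K, hK, hKF⟩ := exists_contDiff_eventuallyEq hU hF hx₀
      have hsm : ContDiff ℝ ∞ fun q : V × ℝ => fderiv ℝ K (q.1 - ((1 - q.2) * l q.1) • v) v := by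
        have h1 : ContDiff ℝ ∞ fun q : V × ℝ => q.1 - ((1 - q.2) * l q.1) • v :=
          contDiff_fst.sub (((contDiff_const.sub contDiff_snd).mul
            (l.contDiff.comp contDiff_fst)).smul contDiff_const)
        exact ((hK.fderiv_right (m := ∞) (by simp)).comp h1).clm_apply contDiff_const
      refine (contDiff_integral_zero_one hsm).contDiffAt.congr_of_eventuallyEq ?_
      have hproj : Tendsto (fun x => x - l x • v) (𝓝 x₀) (𝓝 x₀) := by
        have : Continuous fun x => x - l x • v := by fun_prop
        simpa [h0] using this.tendsto x₀
      have hev := hKF.and (hU.mem_nhds hx₀)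
      filter_upwards [hKF.eventuallyEq_nhds, hproj.eventually hev] with x hx hpx
      split_ifs with hlx
      · simp [hlx, hx.fderiv_eq]
      · have hFTC : ∫ t in (0 : ℝ)..1, l x * fderiv ℝ K (x - ((1 - t) * l x) • v) v =
            K (x - ((1 - 1) * l x) • v) - K (x - ((1 - 0) * l x) • v) := by
          refine intervalIntegral.integral_eq_sub_of_hasDerivAt
            (f := fun t : ℝ => K (x - ((1 - t) * l x) • v)) (fun t _ => ?_) ?_
          · have h1 : HasDerivAt (fun t : ℝ => x - ((1 - t) * l x) • v) (l x • v) t := by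
              have := ((((hasDerivAt_id t).const_sub 1).mul_const (l x)).smul_const v).const_sub x
              simpa using this
            have h2 := ((hK.differentiable (by simp)) (x - ((1 - t) * l x) • v)).hasFDerivAt
            have := h2.comp_hasDerivAt t h1
            simpa [Function.comp_def] using this
          · refine Continuous.intervalIntegrable ?_ _ _
            exact continuous_const.mul (hsm.continuous.comp (continuous_const.prodMk continuous_id))
        have hz : F (x - l x • v) = 0 := hzero _ hpx.2 (by simp [hv])
        rw [intervalIntegral.integral_const_mul] at hFTC
        simp only [sub_self, zero_mul, zero_smul, sub_zero, one_mul, hpx.1, hz] at hFTC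
        rw [div_eq_iff hlx, ← hx.eq_of_nhds, ← hFTC, mul_comm]
    · have h1 : ContDiffAt ℝ ∞ (fun x => F x / l x) x₀ :=
        (hF.contDiffAt (hU.mem_nhds hx₀)).div l.contDiff.contDiffAt h0
      refine h1.congr_of_eventuallyEq ?_
      filter_upwards [l.continuous.continuousAt.eventually_ne h0] with x hx
      rw [if_neg hx]
  · dsimp only
    split_ifs with hlx
    · rw [hlx, zero_mul, hzero x hx hlx]
    · field_simp

/-- A smooth function vanishing on finitely many distinct hyperplanes is divisible by the product
of their equations. -/
lemma exists_contDiffOn_div_prod {V : Type*} [NormedAddCommGroup V] [NormedSpace ℝ V]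
    [FiniteDimensional ℝ V] {U : Set V} (hU : IsOpen U) {F : V → ℝ} (hF : ContDiffOn ℝ ∞ F U)
    {ι : Type*} (s : Finset ι) {l : ι → V →L[ℝ] ℝ} (hl : ∀ i ∈ s, l i ≠ 0)
    (hpair : ∀ i ∈ s, ∀ j ∈ s, i ≠ j → ∃ u, l i u ≠ 0 ∧ l j u = 0)
    (hzero : ∀ i ∈ s, ∀ x ∈ U, l i x = 0 → F x = 0) :
    ∃ G : V → ℝ, ContDiffOn ℝ ∞ G U ∧ ∀ x ∈ U, F x = (∏ i ∈ s, l i x) * G x := by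
  induction s using Finset.induction_on generalizing F with
  | empty => exact ⟨F, hF, by simp⟩
  | insert i s hi ih =>
    obtain ⟨G, hG, hFG⟩ := exists_contDiffOn_div hU hF (hl i (mem_insert_self i s))
      (hzero i (mem_insert_self i s))
    obtain ⟨K, hK, hGK⟩ := ih hG (fun j hj => hl j (mem_insert_of_mem hj))
      (fun j hj k hk => hpair j (mem_insert_of_mem hj) k (mem_insert_of_mem hk)) (by
        intro j hj x hx hjx
        obtain ⟨u, hiu, hju⟩ := hpair i (mem_insert_self i s) j (mem_insert_of_mem hj)
          (by rintro rfl; exact hi hj)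
        have hcont : Tendsto (fun ε : ℝ => x + ε • u) (𝓝[≠] 0) (𝓝 x) := by
          have : Continuous fun ε : ℝ => x + ε • u := by fun_prop
          simpa using (this.tendsto 0).mono_left nhdsWithin_le_nhds
        have hlim := (hG.continuousOn.continuousAt (hU.mem_nhds hx)).tendsto.comp hcont
        refine tendsto_nhds_unique hlim (tendsto_const_nhds.congr' ?_)
        have h1 : ∀ᶠ ε : ℝ in 𝓝[≠] 0, l i (x + ε • u) ≠ 0 := by
          by_cases hix : l i x = 0
          · filter_upwards [self_mem_nhdsWithin] with ε hε
            simpa [hix] using ⟨hε, hiu⟩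
          · exact hcont.eventually ((l i).continuous.continuousAt.eventually_ne hix)
        filter_upwards [h1, hcont.eventually (hU.mem_nhds hx)] with ε h1 h2
        have h3 := hFG _ h2
        rw [hzero j (mem_insert_of_mem hj) _ h2 (by simp [hjx, hju])] at h3
        exact ((mul_eq_zero.1 h3.symm).resolve_left h1).symm)
    refine ⟨K, hK, fun x hx => ?_⟩
    rw [prod_insert hi, hFG x hx, hGK x hx, mul_assoc]

/-- No two elements of `P` are proportional, and none is zero. -/
def PairwiseIndep {d : ℕ} (P : Finset (E d)) : Prop :=
  (0 : E d) ∉ P ∧ ∀ α ∈ P, ∀ β ∈ P, α ≠ β → ∃ u : E d, ⟪α, u⟫ ≠ 0 ∧ ⟪β, u⟫ = 0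

lemma IsRootSet.pairwiseIndep {d : ℕ} {S : Finset (E d)} (hS : IsRootSet S) (v : E d) :
    PairwiseIndep (posRoots S v) := by
  refine ⟨fun h => hS.zero_notMem (mem_posRoots.1 h).1, fun α hα β hβ hne => ?_⟩
  rw [mem_posRoots] at hα hβ
  have hne2 : α ≠ -β := by
    rintro rfl
    have := hα.2
    rw [inner_neg_left] at this
    linarith [hβ.2]
  have hcs := hS.inner_mul_inner_lt hα.1 hβ.1 hne hne2
  refine ⟨⟪β, β⟫ • α - ⟪α, β⟫ • β, ?_, ?_⟩
  · rw [inner_sub_right, real_inner_smul_right, real_inner_smul_right]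
    intro h; linarith
  · rw [inner_sub_right, real_inner_smul_right, real_inner_smul_right, real_inner_comm β α]
    ring

lemma exists_contDiffOn_div_piP {d : ℕ} {P : Finset (E d)} (hP : PairwiseIndep P)
    {U : Set (E d × E d)} (hU : IsOpen U) {F : E d × E d → ℝ} (hF : ContDiffOn ℝ ∞ F U)
    (h₁ : ∀ α ∈ P, ∀ p ∈ U, ⟪α, p.1⟫ = 0 → F p = 0)
    (h₂ : ∀ α ∈ P, ∀ p ∈ U, ⟪α, p.2⟫ = 0 → F p = 0) :
    ∃ G : E d × E d → ℝ, ContDiffOn ℝ ∞ G U ∧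
      ∀ p ∈ U, F p = piP P p.1 * piP P p.2 * G p := by
  let l : E d ⊕ E d → (E d × E d) →L[ℝ] ℝ := Sum.elim
    (fun α => (innerSL ℝ α).comp (ContinuousLinearMap.fst ℝ (E d) (E d)))
    (fun α => (innerSL ℝ α).comp (ContinuousLinearMap.snd ℝ (E d) (E d)))
  have hl₁ : ∀ α p, l (Sum.inl α) p = ⟪α, p.1⟫ := fun α p => rfl
  have hl₂ : ∀ α p, l (Sum.inr α) p = ⟪α, p.2⟫ := fun α p => rfl
  have hself : ∀ α ∈ P, ⟪α, α⟫ ≠ 0 := fun α hα h =>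
    hP.1 (inner_self_eq_zero.1 h ▸ hα)
  obtain ⟨G, hG, hFG⟩ := exists_contDiffOn_div_prod hU hF (P.disjSum P) (l := l) (by
      rintro (α | α) hα h
      · have := congrArg (fun f => f (α, 0)) h
        exact hself α (by simpa using hα) this
      · have := congrArg (fun f => f (0, α)) h
        exact hself α (by simpa using hα) this)
    (by
      rintro (α | α) hα (β | β) hβ hne
      · obtain ⟨u, hu⟩ := hP.2 α (by simpa using hα) β (by simpa using hβ) (by simpa using hne)
        exact ⟨(u, 0), hu⟩
      · exact ⟨(α, 0), hself α (by simpa using hα), by simp [hl₂]⟩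
      · exact ⟨(0, α), hself α (by simpa using hα), by simp [hl₁]⟩
      · obtain ⟨u, hu⟩ := hP.2 α (by simpa using hα) β (by simpa using hβ) (by simpa using hne)
        exact ⟨(0, u), hu⟩)
    (by
      rintro (α | α) hα
      · exact h₁ α (by simpa using hα)
      · exact h₂ α (by simpa using hα))
  refine ⟨G, hG, fun p hp => ?_⟩
  rw [hFG p hp, prod_disjSum]
  rfl

/-- The sum of `f X (w Y)` over `w ∈ T`, weighted by the determinant of `w`. -/
def altSum {d : ℕ} (T : Finset (E d ≃ₗᵢ[ℝ] E d)) (f : E d → E d → ℝ) (X Y : E d) : ℝ :=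
  ∑ w ∈ T, dsign w * f X (w Y)

section altSum

variable {d : ℕ} {T : Finset (E d ≃ₗᵢ[ℝ] E d)} {f : E d → E d → ℝ} {P : Finset (E d)}

lemma mul_reflIso_ne {α : E d} (hα : α ≠ 0) (w : E d ≃ₗᵢ[ℝ] E d) (hw : dsign w ≠ 0) :
    dsign (w * reflIso α) ≠ dsign w ∧ dsign (reflIso α * w) ≠ dsign w := by
  rw [dsign_mul, dsign_mul, dsign_reflIso hα]
  constructor <;> intro h <;> apply hw <;> linarith

lemma altSum_eq_zero_left (hf : ∀ (g : E d ≃ₗᵢ[ℝ] E d) x y, f (g x) (g y) = f x y) {α : E d}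
    (hα : α ≠ 0) (hT : ∀ w ∈ T, reflIso α * w ∈ T) {X : E d} (hX : ⟪α, X⟫ = 0) (Y : E d) :
    altSum T f X Y = 0 := by
  refine sum_involution (fun w _ => reflIso α * w) (fun w _ => ?_) (fun w _ h h' => ?_)
    (fun w hw => hT w hw) (fun w _ => by rw [← mul_assoc, reflIso_mul_self, one_mul])
  · have := hf (reflIso α) X (w Y)
    rw [reflIso_eq_of_inner_eq_zero hX] at this
    rw [dsign_mul, dsign_reflIso hα, LinearIsometryEquiv.coe_mul, Function.comp_apply, this]
    ring
  · exact (mul_reflIso_ne hα w (left_ne_zero_of_mul h)).2 (congrArg dsign h')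

lemma altSum_eq_zero_right {α : E d} (hα : α ≠ 0) (hT : ∀ w ∈ T, w * reflIso α ∈ T) (X : E d)
    {Y : E d} (hY : ⟪α, Y⟫ = 0) : altSum T f X Y = 0 := by
  refine sum_involution (fun w _ => w * reflIso α) (fun w _ => ?_) (fun w _ h h' => ?_)
    (fun w hw => hT w hw) (fun w _ => by rw [mul_assoc, reflIso_mul_self, mul_one])
  · rw [dsign_mul, dsign_reflIso hα, LinearIsometryEquiv.coe_mul, Function.comp_apply,
      reflIso_eq_of_inner_eq_zero hY]
    ring
  · exact (mul_reflIso_ne hα w (left_ne_zero_of_mul h)).1 (congrArg dsign h')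

lemma exists_altSum_eq (hP : PairwiseIndep P) (hl : ∀ α ∈ P, ∀ w ∈ T, reflIso α * w ∈ T)
    (hr : ∀ α ∈ P, ∀ w ∈ T, w * reflIso α ∈ T)
    (hf : ∀ (g : E d ≃ₗᵢ[ℝ] E d) x y, f (g x) (g y) = f x y) {U : Set (E d × E d)}
    (hU : IsOpen U) (hfU : ∀ w ∈ T, ContDiffOn ℝ ∞ (fun p : E d × E d => f p.1 (w p.2)) U) :
    ∃ G : E d × E d → ℝ, ContDiffOn ℝ ∞ G U ∧
      ∀ p ∈ U, altSum T f p.1 p.2 = piP P p.1 * piP P p.2 * G p := by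
  have h0 : ∀ α ∈ P, α ≠ 0 := fun α hα h => hP.1 (h ▸ hα)
  exact exists_contDiffOn_div_piP hP hU (F := fun p => altSum T f p.1 p.2)
    (ContDiffOn.sum fun w hw => contDiffOn_const.mul (hfU w hw))
    (fun α hα p _ h => altSum_eq_zero_left hf (h0 α hα) (hl α hα) h _)
    (fun α hα p _ h => altSum_eq_zero_right (h0 α hα) (hr α hα) _ h)

lemma piP_smul (P : Finset (E d)) (t : ℝ) (X : E d) : piP P (t • X) = t ^ #P * piP P X := by
  simp [piP, real_inner_smul_right, prod_mul_distrib]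

lemma continuous_piP (P : Finset (E d)) : Continuous (piP P) :=
  continuous_finsetProd _ fun _ _ => continuous_const.inner continuous_id

/-- The alternating moments vanish below degree `#P`, and are a multiple of `π(ξ) π(u)` in
degree `#P`. -/
lemma exists_altSum_inner_pow (hP : PairwiseIndep P) (hl : ∀ α ∈ P, ∀ w ∈ T, reflIso α * w ∈ T)
    (hr : ∀ α ∈ P, ∀ w ∈ T, w * reflIso α ∈ T) :
    ∃ c : ℝ, ∀ k ≤ #P, ∀ ξ u : E d, altSum T (fun x y => ⟪x, y⟫ ^ k) ξ u =
      if k = #P then c * piP P ξ * piP P u else 0 := by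
  have key : ∀ k, ∃ c : ℝ, k ≤ #P → ∀ ξ u : E d, altSum T (fun x y => ⟪x, y⟫ ^ k) ξ u =
      0 ^ (#P - k) * (c * piP P ξ * piP P u) := by
    intro k
    obtain ⟨G, hG, hFG⟩ := exists_altSum_eq (f := fun x y => ⟪x, y⟫ ^ k) hP hl hr
      (fun g x y => by rw [LinearIsometryEquiv.inner_map_map]) isOpen_univ (fun w _ =>
        ((contDiff_fst.inner ℝ (w.contDiff.comp contDiff_snd)).pow k).contDiffOn)
    rw [contDiffOn_univ] at hG
    refine ⟨G (0, 0), fun hk ξ u => ?_⟩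
    have hlim : Tendsto (fun t : ℝ =>
        (t * t) ^ (#P - k) * (G (t • ξ, t • u) * piP P ξ * piP P u)) (𝓝[≠] 0)
        (𝓝 (0 ^ (#P - k) * (G (0, 0) * piP P ξ * piP P u))) := by
      have hc : Continuous fun t : ℝ =>
          (t * t) ^ (#P - k) * (G (t • ξ, t • u) * piP P ξ * piP P u) := by
        have := hG.continuous
        fun_prop
      simpa using (hc.tendsto 0).mono_left nhdsWithin_le_nhds
    refine tendsto_nhds_unique (tendsto_const_nhds.congr' ?_) hlim
    filter_upwards [self_mem_nhdsWithin] with t ht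
    have ht : t ≠ 0 := ht
    have h1 := hFG (t • ξ, t • u) (Set.mem_univ _)
    have h2 : altSum T (fun x y => ⟪x, y⟫ ^ k) (t • ξ) (t • u) =
        (t * t) ^ k * altSum T (fun x y => ⟪x, y⟫ ^ k) ξ u := by
      simp only [altSum, mul_sum, map_smul, real_inner_smul_left, real_inner_smul_right]
      exact sum_congr rfl fun w _ => by ring
    rw [h2] at h1
    have htk : (t * t) ^ k ≠ 0 := pow_ne_zero _ (mul_ne_zero ht ht)
    apply mul_left_cancel₀ htk
    rw [h1, ← mul_assoc, ← pow_add, Nat.add_sub_cancel' hk, piP_smul, piP_smul, mul_pow]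
    ring
  choose c hc using key
  refine ⟨c #P, fun k hk ξ u => ?_⟩
  rw [hc k hk]
  split_ifs with h
  · simp [h]
  · rw [zero_pow (by omega), zero_mul]

/-- If the alternating moments of `s` of degree below `n` vanish, then the leading term of
`∑ w, det w * g (s w * h)` as `h → 0` comes from degree `n`. -/
lemma tendsto_sum_mul_comp_div {ι κ : Type*} {l : Filter κ} (T : Finset ι) (b s : ι → ℝ) {n : ℕ}
    {g : ℝ → ℝ} {a : ℕ → ℝ}
    (hg : (fun x => g x - ∑ k ∈ range (n + 1), a k * x ^ k) =o[𝓝 0] fun x => x ^ n)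
    (hs : ∀ k < n, ∑ i ∈ T, b i * s i ^ k = 0) {h : κ → ℝ} (hh : Tendsto h l (𝓝[≠] 0)) :
    Tendsto (fun x => (∑ i ∈ T, b i * g (s i * h x)) / h x ^ n) l
      (𝓝 (a n * ∑ i ∈ T, b i * s i ^ n)) := by
  have hh0 : Tendsto h l (𝓝 0) := hh.mono_right nhdsWithin_le_nhds
  have hr : ∀ i, Tendsto (fun x => (g (s i * h x) - ∑ k ∈ range (n + 1), a k * (s i * h x) ^ k) /
      h x ^ n) l (𝓝 0) := by
    intro i
    have h1 : Tendsto (fun x => s i * h x) l (𝓝 0) := by simpa using hh0.const_mul (s i)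
    have h2 := hg.comp_tendsto h1
    refine (h2.trans_isBigO ?_).tendsto_div_nhds_zero
    simp only [Function.comp_def, mul_pow]
    exact Asymptotics.isBigO_const_mul_self _ _ _
  have hsum := tendsto_finsetSum T fun i _ => (hr i).const_mul (b i)
  have := hsum.add_const (a n * ∑ i ∈ T, b i * s i ^ n)
  simp only [mul_zero, sum_const_zero, zero_add] at this
  refine this.congr' ?_
  filter_upwards [hh.eventually self_mem_nhdsWithin] with x hx
  have hx : h x ≠ 0 := hx
  have h3 : ∑ i ∈ T, b i * ∑ k ∈ range (n + 1), a k * (s i * h x) ^ k =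
      a n * h x ^ n * ∑ i ∈ T, b i * s i ^ n := by
    simp_rw [mul_sum]
    rw [sum_comm, sum_range_succ, sum_eq_zero, zero_add]
    · exact sum_congr rfl fun i _ => by ring
    · intro k hk
      have := hs k (mem_range.1 hk)
      calc ∑ i ∈ T, b i * (a k * (s i * h x) ^ k) = a k * h x ^ k * ∑ i ∈ T, b i * s i ^ k := by
            rw [mul_sum]; exact sum_congr rfl fun i _ => by ring
        _ = 0 := by rw [this, mul_zero]
  have h4 : ∑ i ∈ T, b i * ((g (s i * h x) - ∑ k ∈ range (n + 1), a k * (s i * h x) ^ k) /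
      h x ^ n) = (∑ i ∈ T, b i * g (s i * h x) - a n * h x ^ n * ∑ i ∈ T, b i * s i ^ n) /
      h x ^ n := by
    rw [← h3, ← sum_sub_distrib, sum_div]
    exact sum_congr rfl fun i _ => by ring
  rw [h4, sub_div, mul_right_comm, mul_div_cancel_right₀ _ (pow_ne_zero n hx), sub_add_cancel]

lemma sub_sum_isLittleO_of_hasFPowerSeriesAt {g : ℝ → ℝ} {a : ℕ → ℝ}
    (hg : HasFPowerSeriesAt g (FormalMultilinearSeries.ofScalars ℝ a) 0) (n : ℕ) :
    (fun x => g x - ∑ k ∈ range (n + 1), a k * x ^ k) =o[𝓝 0] fun x => x ^ n := by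
  have h := hg.isBigO_sub_partialSum_pow (n + 1)
  have h2 : (fun x : ℝ => g (0 + x) - (FormalMultilinearSeries.ofScalars ℝ a).partialSum (n + 1) x)
      = fun x => g x - ∑ k ∈ range (n + 1), a k * x ^ k := by
    ext x
    simp [FormalMultilinearSeries.partialSum, mul_comm]
  rw [h2] at h
  refine h.trans_isLittleO ?_
  have : (fun x : ℝ => ‖x‖ ^ (n + 1)) = fun x : ℝ => ‖x ^ (n + 1)‖ := by ext x; simp
  rw [this, Asymptotics.isLittleO_norm_left]
  exact Asymptotics.isLittleO_pow_pow (Nat.lt_succ_self n)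

end altSum

namespace IsRootSet

variable {d : ℕ} {S : Finset (E d)} {v : E d} {T : Finset (E d ≃ₗᵢ[ℝ] E d)}

lemma piP_posSum_pos (hS : IsRootSet S) (hv : ∀ α ∈ S, ⟪α, v⟫ ≠ 0) :
    0 < piP (posRoots S v) (posSum S v) :=
  prod_pos fun α hα => hS.inner_posSum_pos hv α hα

/-- The leading alternating moment of the Weyl group. -/
lemma exists_altSum_inner_pow (hS : IsRootSet S) (hv : ∀ α ∈ S, ⟪α, v⟫ ≠ 0)
    (hT : ∀ w, w ∈ T ↔ w ∈ weylGroup S) :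
    ∃ c : ℝ, c * piP (posRoots S v) (posSum S v) =
        (#(posRoots S v)).factorial * 2 ^ #(posRoots S v) ∧
      ∀ k ≤ #(posRoots S v), ∀ ξ u : E d, altSum T (fun x y => ⟪x, y⟫ ^ k) ξ u =
        if k = #(posRoots S v) then c * piP (posRoots S v) ξ * piP (posRoots S v) u else 0 := by
  obtain ⟨c, hc⟩ := _root_.exists_altSum_inner_pow (T := T) (hS.pairwiseIndep v)
    (fun α hα w hw => (hT _).2 ((weylGroup S).mul_mem
      (reflIso_mem_weylGroup (mem_posRoots.1 hα).1) ((hT w).1 hw)))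
    (fun α hα w hw => (hT _).2 ((weylGroup S).mul_mem ((hT w).1 hw)
      (reflIso_mem_weylGroup (mem_posRoots.1 hα).1)))
  refine ⟨c, ?_, hc⟩
  set P := posRoots S v
  set ρ := posSum S v
  let _ : Fintype (weylGroup S) := Fintype.subtype T hT
  have hexp : HasFPowerSeriesAt Real.exp
      (FormalMultilinearSeries.ofScalars ℝ fun n => ((n.factorial : ℝ))⁻¹) 0 := by
    rw [Real.exp_eq_exp_ℝ, ← NormedSpace.expSeries_eq_ofScalars]
    exact NormedSpace.exp_hasFPowerSeriesAt_zero
  have h1 := tendsto_sum_mul_comp_div (l := 𝓝[≠] (0 : ℝ)) T dsign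
    (fun w => ⟪ρ, w ((2⁻¹ : ℝ) • ρ)⟫) (sub_sum_isLittleO_of_hasFPowerSeriesAt hexp #P)
    (fun k hk => (hc k hk.le ρ ((2⁻¹ : ℝ) • ρ)).trans (if_neg hk.ne)) tendsto_id
  have h2 : ∑ w ∈ T, dsign w * ⟪ρ, w ((2⁻¹ : ℝ) • ρ)⟫ ^ #P =
      c * piP P ρ * piP P ((2⁻¹ : ℝ) • ρ) := (hc #P le_rfl ρ _).trans (if_pos rfl)
  rw [h2] at h1
  have h3 : Tendsto (fun t : ℝ => ∏ α ∈ P, t⁻¹ *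
      (Real.exp (⟪α, t • ρ⟫ / 2) - Real.exp (-⟪α, t • ρ⟫ / 2))) (𝓝[≠] 0) (𝓝 (piP P ρ)) := by
    refine tendsto_finsetProd _ fun α _ => ?_
    have hd : HasDerivAt (fun t : ℝ => Real.exp (⟪α, t • ρ⟫ / 2) - Real.exp (-⟪α, t • ρ⟫ / 2))
        ⟪α, ρ⟫ 0 := by
      simp only [real_inner_smul_right]
      have e1 := (((hasDerivAt_id (0 : ℝ)).mul_const ⟪α, ρ⟫).div_const 2).exp
      have e2 := (((hasDerivAt_id (0 : ℝ)).mul_const ⟪α, ρ⟫).neg.div_const 2).exp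
      exact (e1.sub e2).congr_deriv (by simp; ring)
    simpa using hd.tendsto_slope_zero
  have h4 : piP P ρ = ((#P).factorial : ℝ)⁻¹ * (c * piP P ρ * piP P ((2⁻¹ : ℝ) • ρ)) := by
    refine tendsto_nhds_unique (h3.congr' ?_) h1
    filter_upwards [self_mem_nhdsWithin] with t ht
    rw [prod_mul_distrib, weyl_denominator hS hv, prod_const, altExp, div_eq_inv_mul, inv_pow, id]
    congr 1
    rw [sum_subtype T hT fun w => dsign w * Real.exp (⟪ρ, w ((2⁻¹ : ℝ) • ρ)⟫ * t)]
    refine sum_congr rfl fun w _ => ?_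
    rw [real_inner_smul_right, real_inner_comm, mul_comm t]
  have hpos := hS.piP_posSum_pos hv
  rw [piP_smul] at h4
  have hf : ((#P).factorial : ℝ) ≠ 0 := by positivity
  apply mul_left_cancel₀ hpos.ne'
  rw [inv_pow] at h4
  field_simp at h4
  linear_combination -h4

end IsRootSet

/-- The Newton kernel of `ℝ^d`, up to a constant factor. -/
def newton {d : ℕ} (X Y : E d) : ℝ := ‖X - Y‖ ^ ((2 : ℝ) - (d : ℝ))

lemma newton_map {d : ℕ} (g : E d ≃ₗᵢ[ℝ] E d) (x y : E d) : newton (g x) (g y) = newton x y := by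
  rw [newton, newton, ← map_sub, LinearIsometryEquiv.norm_map]

lemma factorial_mul_choose (ν : ℝ) (n : ℕ) :
    (n.factorial : ℝ) * Ring.choose (ν + n - 1) n = ∏ k ∈ range n, (ν + (k : ℝ)) := by
  rw [← Ring.multichoose_eq, ← nsmul_eq_mul, Ring.factorial_nsmul_multichoose_eq_ascPochhammer,
    Polynomial.ascPochhammer_smeval_eq_eval]
  induction n with
  | zero => simp
  | succ n ih => rw [ascPochhammer_succ_eval, ih, prod_range_succ]

/-- The Newton kernel in terms of `r = ‖ξ‖² + ε² ‖u‖²` and the normalised inner product. -/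
lemma newton_smul_eq {d : ℕ} (w : E d ≃ₗᵢ[ℝ] E d) {ξ u : E d} {ε r : ℝ}
    (hr : r = ‖ξ‖ ^ 2 + ε ^ 2 * ‖u‖ ^ 2) (hr0 : 0 < r) :
    newton ξ (w (ε • u)) = r ^ (-(((d : ℝ) - 2) / 2)) *
      (1 / (1 - ⟪ξ, w u⟫ * (2 * ε / r)) ^ (((d : ℝ) - 2) / 2)) := by
  have h1 : ‖ξ - w (ε • u)‖ ^ 2 = r * (1 - ⟪ξ, w u⟫ * (2 * ε / r)) := by
    rw [norm_sub_sq_real, LinearIsometryEquiv.norm_map, norm_smul, map_smul,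
      real_inner_smul_right, mul_pow, Real.norm_eq_abs, sq_abs]
    field_simp
    rw [hr]
    ring
  have h2 : 0 ≤ 1 - ⟪ξ, w u⟫ * (2 * ε / r) := by
    have := sq_nonneg ‖ξ - w (ε • u)‖
    rw [h1] at this
    exact (mul_nonneg_iff_of_pos_left hr0).1 this
  rw [newton, one_div, ← Real.rpow_neg h2, ← Real.mul_rpow hr0.le h2, ← h1, ← Real.rpow_natCast,
    ← Real.rpow_mul (norm_nonneg _)]
  congr 1
  push_cast
  ring

namespace IsRootSet

variable {d : ℕ} {S : Finset (E d)} {v : E d} {T : Finset (E d ≃ₗᵢ[ℝ] E d)}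

/-- The value at `(ξ, 0)` of the quotient of the alternating Newton sum by `π(X) π(Y)`. -/
theorem norm_pow_mul_quotient (hd : 3 ≤ d) (hS : IsRootSet S) (hv : ∀ α ∈ S, ⟪α, v⟫ ≠ 0)
    (hT : ∀ w, w ∈ T ↔ w ∈ weylGroup S) {U : Set (E d × E d)} (hU : IsOpen U)
    {G : E d × E d → ℝ} (hG : ContinuousOn G U)
    (hFG : ∀ p ∈ U, altSum T newton p.1 p.2 =
      piP (posRoots S v) p.1 * piP (posRoots S v) p.2 * G p)
    {ξ : E d} (hξ : ξ ≠ 0) (hξU : (ξ, 0) ∈ U) :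
    ‖ξ‖ ^ (2 * #(posRoots S v) + d - 2) * G (ξ, 0) = 2 ^ (2 * #(posRoots S v)) *
      (∏ k ∈ range #(posRoots S v), (((d : ℝ) - 2) / 2 + (k : ℝ))) /
      piP (posRoots S v) (posSum S v) := by
  obtain ⟨c, hc, hmom⟩ := hS.exists_altSum_inner_pow hv hT
  have hρ := hS.piP_posSum_pos hv
  have hpv : piP (posRoots S v) v ≠ 0 := prod_ne_zero_iff.2 fun α hα => (mem_posRoots.1 hα).2.ne'
  set P := posRoots S v
  set n := #P
  set ν := ((d : ℝ) - 2) / 2 with hν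
  wlog hreg : piP P ξ ≠ 0 generalizing ξ
  · have hpath : Tendsto (fun ε : ℝ => ξ + ε • v) (𝓝[≠] 0) (𝓝 ξ) := by
      have : Continuous fun ε : ℝ => ξ + ε • v := by fun_prop
      simpa using (this.tendsto 0).mono_left nhdsWithin_le_nhds
    have hpath2 : Tendsto (fun ε : ℝ => ((ξ + ε • v, 0) : E d × E d)) (𝓝[≠] 0) (𝓝 (ξ, 0)) :=
      hpath.prodMk_nhds tendsto_const_nhds
    refine tendsto_nhds_unique ((hpath.norm.pow _).mul
      ((hG.continuousAt (hU.mem_nhds hξU)).tendsto.comp hpath2))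
      (tendsto_const_nhds.congr' ?_)
    filter_upwards [hpath.eventually_ne hξ, hpath2.eventually (hU.mem_nhds hξU),
      eventually_inner_ne_zero P (x := ξ) (u := v) fun α hα _ => (mem_posRoots.1 hα).2.ne']
      with ε h1 h2 h3
    exact (this h1 h2 (prod_ne_zero_iff.2 h3)).symm
  have hr0 : ∀ ε : ℝ, 0 < ‖ξ‖ ^ 2 + ε ^ 2 * ‖v‖ ^ 2 := fun ε => by
    have := norm_pos_iff.2 hξ
    positivity
  set r : ℝ → ℝ := fun ε => ‖ξ‖ ^ 2 + ε ^ 2 * ‖v‖ ^ 2 with hr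
  have hrc : Continuous r := by fun_prop
  have hhc : Tendsto (fun ε => 2 * ε / r ε) (𝓝[≠] 0) (𝓝[≠] 0) := by
    refine tendsto_nhdsWithin_iff.2 ⟨?_, ?_⟩
    · have : Continuous fun ε => 2 * ε / r ε :=
        (continuous_const.mul continuous_id).div hrc fun ε => (hr0 ε).ne'
      simpa using (this.tendsto 0).mono_left nhdsWithin_le_nhds
    · filter_upwards [self_mem_nhdsWithin] with ε hε
      exact div_ne_zero (mul_ne_zero two_ne_zero hε) (hr0 ε).ne'
  have hlim := tendsto_sum_mul_comp_div T dsign (fun w => ⟪ξ, w v⟫)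
    (sub_sum_isLittleO_of_hasFPowerSeriesAt
      (Real.one_div_one_sub_rpow_hasFPowerSeriesOnBall_zero ν).hasFPowerSeriesAt n)
    (fun k hk => (hmom k hk.le ξ v).trans (if_neg hk.ne)) hhc
  have hmom' : ∑ w ∈ T, dsign w * ⟪ξ, w v⟫ ^ n = c * piP P ξ * piP P v :=
    (hmom n le_rfl ξ v).trans (if_pos rfl)
  rw [hmom'] at hlim
  have hpre : Tendsto (fun ε => r ε ^ (-ν) * (2 / r ε) ^ n) (𝓝[≠] 0)
      (𝓝 ((‖ξ‖ ^ 2) ^ (-ν) * (2 / ‖ξ‖ ^ 2) ^ n)) := by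
    have h1 : Continuous fun ε => r ε ^ (-ν) * (2 / r ε) ^ n :=
      (hrc.rpow_const fun ε => Or.inl (hr0 ε).ne').mul
        ((continuous_const.div hrc fun ε => (hr0 ε).ne').pow n)
    simpa [hr] using (h1.tendsto 0).mono_left nhdsWithin_le_nhds
  have hpath : Tendsto (fun ε : ℝ => ((ξ, ε • v) : E d × E d)) (𝓝[≠] 0) (𝓝 (ξ, 0)) := by
    have : Continuous fun ε : ℝ => ((ξ, ε • v) : E d × E d) := by fun_prop
    simpa using (this.tendsto 0).mono_left nhdsWithin_le_nhds
  have hleft := (((hG.continuousAt (hU.mem_nhds hξU)).tendsto.comp hpath).const_mul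
    (piP P ξ * piP P v))
  have heq : piP P ξ * piP P v * G (ξ, 0) = (‖ξ‖ ^ 2) ^ (-ν) * (2 / ‖ξ‖ ^ 2) ^ n *
      (Ring.choose (ν + n - 1) n * (c * piP P ξ * piP P v)) := by
    refine tendsto_nhds_unique hleft ((hpre.mul hlim).congr' ?_)
    filter_upwards [self_mem_nhdsWithin, hpath.eventually (hU.mem_nhds hξU)] with ε hε hεU
    have hε : ε ≠ 0 := hε
    have h1 := hFG _ hεU
    have h2 : altSum T newton ξ (ε • v) = r ε ^ (-ν) *
        ∑ w ∈ T, dsign w * (1 / (1 - ⟪ξ, w v⟫ * (2 * ε / r ε)) ^ ν) := by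
      rw [altSum, mul_sum]
      refine sum_congr rfl fun w _ => ?_
      rw [newton_smul_eq w rfl (hr0 ε)]
      ring
    dsimp only at h1
    rw [h2, piP_smul] at h1
    have h3 : (2 * ε / r ε) ^ n = (2 / r ε) ^ n * ε ^ n := by rw [← mul_pow]; congr 1; ring
    have h4 : (2 / r ε) ^ n ≠ 0 := pow_ne_zero _ (div_ne_zero two_ne_zero (hr0 ε).ne')
    have h5 : ε ^ n ≠ 0 := pow_ne_zero _ hε
    simp only [Function.comp_apply]
    rw [h3]
    generalize ∑ w ∈ T, dsign w * (1 / (1 - ⟪ξ, w v⟫ * (2 * ε / r ε)) ^ ν) = s at h1 ⊢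
    generalize (2 / r ε) ^ n = q at h4 ⊢
    field_simp
    linear_combination h1
  have hνn : (‖ξ‖ ^ 2) ^ (-ν) * ‖ξ‖ ^ (d - 2) = 1 := by
    rw [← Real.rpow_natCast, ← Real.rpow_natCast, ← Real.rpow_mul (norm_nonneg _),
      ← Real.rpow_add (norm_pos_iff.2 hξ), Nat.cast_sub (by omega)]
    convert Real.rpow_zero _ using 2
    push_cast
    rw [hν]
    ring
  have hG0 : G (ξ, 0) = (‖ξ‖ ^ 2) ^ (-ν) * (2 / ‖ξ‖ ^ 2) ^ n * (Ring.choose (ν + n - 1) n * c) := by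
    apply mul_left_cancel₀ (mul_ne_zero hreg hpv)
    linear_combination heq
  have hξn : ‖ξ‖ ^ (2 * n) * (2 / ‖ξ‖ ^ 2) ^ n = 2 ^ n := by
    rw [pow_mul, ← mul_pow, mul_div_cancel₀ _ (pow_ne_zero 2 (norm_ne_zero_iff.2 hξ))]
  rw [eq_div_iff hρ.ne', hG0, ← factorial_mul_choose, Nat.add_sub_assoc (by omega), pow_add]
  calc _ = ((‖ξ‖ ^ 2) ^ (-ν) * ‖ξ‖ ^ (d - 2)) * (‖ξ‖ ^ (2 * n) * (2 / ‖ξ‖ ^ 2) ^ n) *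
        Ring.choose (ν + n - 1) n * (c * piP P (posSum S v)) := by ring
    _ = _ := by rw [hνn, hξn, hc, two_mul, pow_add]; ring

end IsRootSet

/-- The pairs `(X, Y)` with `X ≠ w Y` for all `w ∈ T`. -/
def offGraphs {d : ℕ} (T : Finset (E d ≃ₗᵢ[ℝ] E d)) : Set (E d × E d) := {p | ∀ w ∈ T, p.1 ≠ w p.2}

lemma isOpen_offGraphs {d : ℕ} (T : Finset (E d ≃ₗᵢ[ℝ] E d)) : IsOpen (offGraphs T) := by
  have : offGraphs T = ⋂ w ∈ T, {p : E d × E d | p.1 ≠ w p.2} := by ext p; simp [offGraphs]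
  rw [this]
  exact isOpen_biInter_finset fun w _ =>
    isOpen_ne_fun continuous_fst (w.continuous.comp continuous_snd)

lemma exists_newton_quotient {d : ℕ} {T : Finset (E d ≃ₗᵢ[ℝ] E d)} {P : Finset (E d)}
    (hP : PairwiseIndep P) (hl : ∀ α ∈ P, ∀ w ∈ T, reflIso α * w ∈ T)
    (hr : ∀ α ∈ P, ∀ w ∈ T, w * reflIso α ∈ T) :
    ∃ G : E d × E d → ℝ, ContinuousOn G (offGraphs T) ∧
      ∀ p ∈ offGraphs T, altSum T newton p.1 p.2 = piP P p.1 * piP P p.2 * G p := by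
  obtain ⟨G, hG, hFG⟩ := exists_altSum_eq hP hl hr newton_map (isOpen_offGraphs T)
    (fun w hw p hp => by
      have hne : p.1 - w p.2 ≠ 0 := sub_ne_zero.2 (hp w hw)
      have hsm : ContDiffAt ℝ ∞ (fun q : E d × E d => q.1 - w q.2) p :=
        (contDiff_fst.sub (w.contDiff.comp contDiff_snd)).contDiffAt
      exact ((hsm.norm ℝ hne).rpow_const_of_ne (norm_ne_zero_iff.2 hne)).contDiffWithinAt)
  exact ⟨G, hG.continuousOn, hFG⟩

/-- Functions that are continuous on an open set and agree at its regular points agree. -/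
lemma eqOn_of_eq_of_piP_ne_zero {d : ℕ} {P : Finset (E d)} {v : E d} (hv : ∀ α ∈ P, ⟪α, v⟫ ≠ 0)
    {U : Set (E d × E d)} (hU : IsOpen U) {f g : E d × E d → ℝ} (hf : ContinuousOn f U)
    (hg : ContinuousOn g U) (h : ∀ p ∈ U, piP P p.1 * piP P p.2 ≠ 0 → f p = g p) : U.EqOn f g := by
  intro p hp
  have hpath : Tendsto (fun ε : ℝ => (p.1 + ε • v, p.2 + ε • v)) (𝓝[≠] 0) (𝓝 p) := by
    have : Continuous fun ε : ℝ => (p.1 + ε • v, p.2 + ε • v) := by fun_prop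
    simpa using (this.tendsto 0).mono_left nhdsWithin_le_nhds
  refine tendsto_nhds_unique ((hf.continuousAt (hU.mem_nhds hp)).tendsto.comp hpath)
    (((hg.continuousAt (hU.mem_nhds hp)).tendsto.comp hpath).congr' ?_)
  filter_upwards [hpath.eventually (hU.mem_nhds hp),
    eventually_inner_ne_zero P (x := p.1) (u := v) fun α hα _ => hv α hα,
    eventually_inner_ne_zero P (x := p.2) (u := v) fun α hα _ => hv α hα] with ε h1 h2 h3
  exact (h _ h1 (mul_ne_zero (prod_ne_zero_iff.2 h2) (prod_ne_zero_iff.2 h3))).symm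

namespace IsRootSet

variable {d : ℕ} {S : Finset (E d)} {v : E d} {T : Finset (E d ≃ₗᵢ[ℝ] E d)}

/-- The leading asymptotics of the quotient of the alternating Newton sum. -/
theorem tendsto_norm_pow_mul_quotient (hd : 3 ≤ d) (hS : IsRootSet S)
    (hv : ∀ α ∈ S, ⟪α, v⟫ ≠ 0) (hT : ∀ w, w ∈ T ↔ w ∈ weylGroup S) {G : E d × E d → ℝ}
    (hG : ContinuousOn G (offGraphs T))
    (hFG : ∀ p ∈ offGraphs T, altSum T newton p.1 p.2 =
      piP (posRoots S v) p.1 * piP (posRoots S v) p.2 * G p)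
    (y : E d) {P : Finset (E d)} (hPdef : P = (posRoots S v).filter fun α => ⟪α, y⟫ = 0) :
    Tendsto (fun X : E d => ‖X - y‖ ^ (2 * #P + d - 2) * G (X, y))
      (𝓝[{X | (X, y) ∈ offGraphs T}] y)
      (𝓝 (2 ^ (2 * #P) * (∏ k ∈ range #P, (((d : ℝ) - 2) / 2 + (k : ℝ))) /
        (piP P (∑ α ∈ P, α) * piP (posRoots S v \ P) y ^ 2))) := by
  have _ : Finite (weylGroup S) := (T.finite_toSet.subset fun w hw => (hT w).2 hw).to_subtype
  have hS' := hS.filter_orthogonal y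
  have hv' : ∀ α ∈ S.filter (fun α => ⟪α, y⟫ = 0), ⟪α, v⟫ ≠ 0 :=
    fun α hα => hv α (mem_filter.1 hα).1
  have hP : P = posRoots (S.filter fun α => ⟪α, y⟫ = 0) v := by
    rw [hPdef, posRoots, posRoots, filter_comm]
  have hPy : ∀ α ∈ P, ⟪α, y⟫ = 0 := fun α hα => by
    rw [hPdef] at hα
    exact (mem_filter.1 hα).2
  have hPS : P ⊆ posRoots S v := hPdef ▸ filter_subset _ _
  have hrefl : ∀ α ∈ P, reflIso α ∈ weylGroup S := fun α hα =>
    reflIso_mem_weylGroup (mem_posRoots.1 (hPS hα)).1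
  have hfix : ∀ α ∈ P, reflIso α y = y := fun α hα => reflIso_eq_of_inner_eq_zero (hPy α hα)
  have hl : ∀ α ∈ P, ∀ w ∈ T, reflIso α * w ∈ T := fun α hα w hw =>
    (hT _).2 ((weylGroup S).mul_mem (hrefl α hα) ((hT w).1 hw))
  have hr : ∀ α ∈ P, ∀ w ∈ T, w * reflIso α ∈ T := fun α hα w hw =>
    (hT _).2 ((weylGroup S).mul_mem ((hT w).1 hw) (hrefl α hα))
  have hind : PairwiseIndep P := hP ▸ hS'.pairwiseIndep v
  have hly : ∀ α ∈ P, ∀ w : E d ≃ₗᵢ[ℝ] E d, (reflIso α * w) y = y ↔ w y = y := fun α hα w => by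
    rw [LinearIsometryEquiv.coe_mul, Function.comp_apply]
    nth_rewrite 2 [← hfix α hα]
    exact (reflIso α).injective.eq_iff
  have hry : ∀ α ∈ P, ∀ w : E d ≃ₗᵢ[ℝ] E d, (w * reflIso α) y = w y := fun α hα w => by
    rw [LinearIsometryEquiv.coe_mul, Function.comp_apply, hfix α hα]
  obtain ⟨G', hG', hFG'⟩ := exists_newton_quotient (T := T.filter fun w => w y = y) hind
    (fun α hα w hw => by
      rw [mem_filter] at hw ⊢
      exact ⟨hl α hα w hw.1, (hly α hα w).2 hw.2⟩)
    (fun α hα w hw => by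
      rw [mem_filter] at hw ⊢
      exact ⟨hr α hα w hw.1, (hry α hα w).trans hw.2⟩)
  obtain ⟨K, hK, hFK⟩ := exists_newton_quotient (T := T.filter fun w => ¬ w y = y) hind
    (fun α hα w hw => by
      rw [mem_filter] at hw ⊢
      exact ⟨hl α hα w hw.1, (hly α hα w).not.2 hw.2⟩)
    (fun α hα w hw => by
      rw [mem_filter] at hw ⊢
      exact ⟨hr α hα w hw.1, by rw [hry α hα w]; exact hw.2⟩)
  have hsub : ∀ p ∈ offGraphs T, (p.1 - y, p.2 - y) ∈ offGraphs (T.filter fun w => w y = y) := by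
    intro p hp w hw h
    rw [mem_filter] at hw
    refine hp w hw.1 ?_
    simpa [hw.2] using h
  have hK' : ContinuousOn K (offGraphs T) :=
    hK.mono fun p hp w hw => hp w (mem_filter.1 hw).1
  have hpi : ∀ X, piP P (X - y) = piP P X := fun X =>
    prod_congr rfl fun α hα => by rw [inner_sub_right, hPy α hα, sub_zero]
  have hsplit : ∀ X, piP (posRoots S v) X = piP (posRoots S v \ P) X * piP P X := fun X =>
    (prod_sdiff hPS).symm
  have key : (offGraphs T).EqOn
      (fun p => piP (posRoots S v \ P) p.1 * piP (posRoots S v \ P) p.2 * G p)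
      (fun p => G' (p.1 - y, p.2 - y) + K p) := by
    refine eqOn_of_eq_of_piP_ne_zero (P := posRoots S v) (v := v)
      (fun α hα => (mem_posRoots.1 hα).2.ne') (isOpen_offGraphs T)
      ?_ ?_ fun p hp hreg => ?_
    · have := continuous_piP (posRoots S v \ P)
      exact ContinuousOn.mul (by fun_prop) hG
    · refine ContinuousOn.add (hG'.comp (Continuous.continuousOn ?_) hsub) hK'
      fun_prop
    · have h1 := hFG p hp
      have h2 := hFG' _ (hsub p hp)
      have h3 := hFK p fun w hw => hp w (mem_filter.1 hw).1
      have h4 : altSum T newton p.1 p.2 =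
          altSum (T.filter fun w => w y = y) newton (p.1 - y) (p.2 - y) +
          altSum (T.filter fun w => ¬ w y = y) newton p.1 p.2 := by
        rw [altSum, ← sum_filter_add_sum_filter_not T fun w => w y = y]
        congr 1
        refine sum_congr rfl fun w hw => ?_
        rw [newton, newton, map_sub, (mem_filter.1 hw).2, sub_sub_sub_cancel_right]
      dsimp only at h2
      rw [h4, h2, h3, hpi, hpi, hsplit, hsplit] at h1
      rw [hsplit, hsplit] at hreg
      have hne : piP P p.1 * piP P p.2 ≠ 0 :=
        mul_ne_zero (right_ne_zero_of_mul (left_ne_zero_of_mul hreg))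
          (right_ne_zero_of_mul (right_ne_zero_of_mul hreg))
      apply mul_left_cancel₀ hne
      linear_combination -h1
  have hconst : ∀ ξ : E d, ξ ≠ 0 → ‖ξ‖ ^ (2 * #P + d - 2) * G' (ξ, 0) = 2 ^ (2 * #P) *
      (∏ k ∈ range #P, (((d : ℝ) - 2) / 2 + (k : ℝ))) / piP P (∑ α ∈ P, α) := by
    intro ξ hξ
    have hT' : ∀ w, w ∈ T.filter (fun w => w y = y) ↔
        w ∈ weylGroup (S.filter fun α => ⟪α, y⟫ = 0) := by
      intro w
      rw [mem_filter, hT]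
      constructor
      · exact fun h => (hS.mem_weylGroup_filter_iff hv y h.1).2 h.2
      · exact fun h => ⟨weylGroup_filter_le S y h,
          (hS.mem_weylGroup_filter_iff hv y (weylGroup_filter_le S y h)).1 h⟩
    rw [hP] at hFG' ⊢
    exact hS'.norm_pow_mul_quotient hd hv' hT' (isOpen_offGraphs _) hG' hFG' hξ
      fun w _ => by rw [map_zero]; exact hξ
  have hone : (1 : E d ≃ₗᵢ[ℝ] E d) ∈ T := (hT 1).2 (weylGroup S).one_mem
  have hy0 : piP (posRoots S v \ P) y ≠ 0 := prod_ne_zero_iff.2 fun α hα h => by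
    rw [Finset.mem_sdiff] at hα
    exact hα.2 (hPdef ▸ mem_filter.2 ⟨hα.1, h⟩)
  have hyK : ContinuousAt K (y, y) := hK.continuousAt
    ((isOpen_offGraphs _).mem_nhds fun w hw h => (mem_filter.1 hw).2 h.symm)
  have hKlim : Tendsto (fun X => K (X, y)) (𝓝 y) (𝓝 (K (y, y))) :=
    hyK.tendsto.comp (tendsto_id.prodMk_nhds tendsto_const_nhds)
  have hnlim : Tendsto (fun X => ‖X - y‖ ^ (2 * #P + d - 2)) (𝓝 y) (𝓝 0) := by
    have : Continuous fun X : E d => ‖X - y‖ ^ (2 * #P + d - 2) := by fun_prop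
    simpa [show 2 * #P + d - 2 ≠ 0 by omega] using this.tendsto y
  have hpilim : Tendsto (fun X => piP (posRoots S v \ P) X) (𝓝 y)
      (𝓝 (piP (posRoots S v \ P) y)) := (continuous_piP _).tendsto y
  have hlim := (((hnlim.mul hKlim).const_add (2 ^ (2 * #P) *
      (∏ k ∈ range #P, (((d : ℝ) - 2) / 2 + (k : ℝ))) / piP P (∑ α ∈ P, α))).div
    (hpilim.mul_const (piP (posRoots S v \ P) y)) (mul_ne_zero hy0 hy0)).mono_left
    (nhdsWithin_le_nhds (s := {X | (X, y) ∈ offGraphs T}))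
  rw [zero_mul, add_zero, ← sq, div_div] at hlim
  refine hlim.congr' ?_
  filter_upwards [self_mem_nhdsWithin,
    nhdsWithin_le_nhds (hpilim.eventually_ne hy0)] with X hX hXpi
  have hXy : X - y ≠ 0 := sub_ne_zero.2 (hX 1 hone)
  have hk := key hX
  simp only [sub_self] at hk
  rw [Pi.div_apply, ← hconst _ hXy, ← mul_add, ← hk]
  field_simp

end IsRootSet

lemma IsRootSystem.isRootSet {d : ℕ} {S : Finset (E d)} (hS : IsRootSystem S)
    (hcrys : ∀ α ∈ S, ∀ β ∈ S, ∃ z : ℤ, 2 * ⟪α, β⟫ / ⟪β, β⟫ = (z : ℝ)) : IsRootSet S where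
  zero_notMem := hS.1
  reduced := hS.2.2.1
  reflIso_mem := fun α hα β hβ => by
    rw [reflIso_apply]
    exact hS.2.2.2 α hα β hβ
  crystallographic := hcrys

end

/-- asymptotics of the Newton kernel. For a crystallographic root system and
`d ≥ 3`, there is a unique continuous function `T_N` on `D` with
`T_N(X,Y) = (π(X)π(Y))⁻¹ ∑_{w∈W} det(w) |X - wY|^{2-d}` whenever `π(X)π(Y) ≠ 0`, and for
every `Y₀`, with `Σ'₊ = {α ∈ Σ⁺ : ⟪α,Y₀⟫ = 0}`, `γ' = |Σ'₊|`, `ρ' = ∑_{α∈Σ'₊} α`,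
`|X - Y₀|^{2γ'+d-2} T_N(X,Y₀) → 2^{2γ'} ((d-2)/2)_{γ'} / (π'(ρ') π''(Y₀)²)` as `X → Y₀`
with `(X,Y₀) ∈ D`. -/
theorem stmt_8 (d : ℕ) (hd : 3 ≤ d) (Sig Sp : Finset (E d))
    (hroot : IsRootSystem Sig) (hpos : IsPositiveSystem Sig Sp)
    (hcrys : ∀ α ∈ Sig, ∀ β ∈ Sig, ∃ z : ℤ, 2 * ⟪α, β⟫ / ⟪β, β⟫ = (z : ℝ))
    [Fintype ↥(weylGroup Sig)]
    (Y₀ : E d)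
    (Sp' : Finset (E d)) (hSp' : Sp' = Sp.filter (fun α => ⟪α, Y₀⟫ = 0)) :
    ∃ TN : E d × E d → ℝ,
      ContinuousOn TN (Dset Sig) ∧
      (∀ X Y : E d, (X, Y) ∈ Dset Sig → piP Sp X * piP Sp Y ≠ 0 →
        TN (X, Y) = (piP Sp X * piP Sp Y)⁻¹ *
          ∑ w : ↥(weylGroup Sig), dsign w.1 * ‖X - w.1 Y‖ ^ ((2 : ℝ) - (d : ℝ))) ∧
      (∀ TN' : E d × E d → ℝ,
        ContinuousOn TN' (Dset Sig) →
        (∀ X Y : E d, (X, Y) ∈ Dset Sig → piP Sp X * piP Sp Y ≠ 0 →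
          TN' (X, Y) = (piP Sp X * piP Sp Y)⁻¹ *
            ∑ w : ↥(weylGroup Sig), dsign w.1 * ‖X - w.1 Y‖ ^ ((2 : ℝ) - (d : ℝ))) →
        ∀ p ∈ Dset Sig, TN' p = TN p) ∧
      Filter.Tendsto (fun X : E d => ‖X - Y₀‖ ^ (2 * Sp'.card + d - 2) * TN (X, Y₀))
        (nhdsWithin Y₀ {X : E d | (X, Y₀) ∈ Dset Sig})
        (nhds (2 ^ (2 * Sp'.card) *
          (∏ k ∈ Finset.range Sp'.card, (((d : ℝ) - 2) / 2 + (k : ℝ))) /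
          (piP Sp' (∑ α ∈ Sp', α) * (piP (Sp \ Sp') Y₀) ^ 2))) := by
  have hS := hroot.isRootSet hcrys
  obtain ⟨v, hv, hmem⟩ := hpos
  obtain rfl : Sp = posRoots Sig v := Finset.ext fun α => by rw [hmem, mem_posRoots]
  set T : Finset (E d ≃ₗᵢ[ℝ] E d) := univ.map (Function.Embedding.subtype (· ∈ weylGroup Sig))
    with hTdef
  have hT : ∀ w, w ∈ T ↔ w ∈ weylGroup Sig := fun w => by simp [hTdef]
  have hD : Dset Sig = offGraphs T := Set.ext fun p =>
    ⟨fun h w hw => h ⟨w, (hT w).1 hw⟩, fun h w => h w.1 ((hT _).2 w.2)⟩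
  have hsum : ∀ X Y : E d, ∑ w : ↥(weylGroup Sig), dsign w.1 * ‖X - w.1 Y‖ ^ ((2 : ℝ) - (d : ℝ)) =
      altSum T newton X Y := fun X Y => by
    rw [altSum, hTdef, sum_map]
    rfl
  have hrefl : ∀ α ∈ posRoots Sig v, reflIso α ∈ weylGroup Sig := fun α hα =>
    IsRootSet.reflIso_mem_weylGroup (mem_posRoots.1 hα).1
  obtain ⟨G, hG, hFG⟩ := exists_newton_quotient (T := T) (hS.pairwiseIndep v)
    (fun α hα w hw => (hT _).2 ((weylGroup Sig).mul_mem (hrefl α hα) ((hT w).1 hw)))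
    (fun α hα w hw => (hT _).2 ((weylGroup Sig).mul_mem ((hT w).1 hw) (hrefl α hα)))
  have hformula : ∀ X Y : E d, (X, Y) ∈ offGraphs T →
      piP (posRoots Sig v) X * piP (posRoots Sig v) Y ≠ 0 →
      G (X, Y) = (piP (posRoots Sig v) X * piP (posRoots Sig v) Y)⁻¹ * altSum T newton X Y :=
    fun X Y hXY hne => by rw [hFG _ hXY, inv_mul_cancel_left₀ hne]
  simp only [hD, hsum]
  refine ⟨G, hG, hformula, fun G' hG' hformula' => ?_, ?_⟩
  · exact eqOn_of_eq_of_piP_ne_zero (P := posRoots Sig v) (v := v)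
      (fun α hα => (mem_posRoots.1 hα).2.ne') (isOpen_offGraphs T) hG' hG
      fun p hp hne => (hformula' _ _ hp hne).trans (hformula _ _ hp hne).symm
  · exact hS.tendsto_norm_pow_mul_quotient hd hv hT hG hFG Y₀ hSp'
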